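/- arXiv:2101.08217 — 2 statements merged into one kernel-verified Lean document; each statement's English description precedes it below -/
import Mathlib

section
/- Let k be any field and let f be a nonzero homogeneous polynomial of degree 3 in four variables over k defining a smooth cubic surface V(f). Then the set of lines on V(f) defined over k is finite, and its cardinality is one of 0, 1, 2, 3, 5, 7, 9, 15, or 27. -/
open MvPolynomial

/-- The restriction of `f` to the line spanned by `v` and `w`:
the polynomial `f (s • v + t • w)` in the two variables `s, t`. -/
noncomputable def lineRestrict {k : Type*} [CommRing k] (f : MvPolynomial (Fin 4) k)
    (v w : Fin 4 → k) : MvPolynomial (Fin 2) k :=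
  aeval (fun i => C (v i) * X 0 + C (w i) * X 1) f

/-- `W` is a line on the cubic surface `V(f)` defined over `k`: a 2-dimensional
`k`-linear subspace of `k⁴` on which `f` vanishes identically as a polynomial. -/
def IsLineOn {k : Type*} [Field k] (f : MvPolynomial (Fin 4) k)
    (W : Submodule k (Fin 4 → k)) : Prop :=
  Module.finrank k W = 2 ∧
    ∃ v w : Fin 4 → k, Submodule.span k {v, w} = W ∧ lineRestrict f v w = 0

/-- `f` defines a smooth cubic surface over `k`: `f` is a nonzero homogeneous cubic
and, over an algebraic closure, the only common zero of `f` and its partial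
derivatives is the origin. -/
def IsSmoothCubic (k : Type*) [Field k] (f : MvPolynomial (Fin 4) k) : Prop :=
  f ≠ 0 ∧ f.IsHomogeneous 3 ∧
    ∀ x : Fin 4 → AlgebraicClosure k,
      (eval x (map (algebraMap k (AlgebraicClosure k)) f) = 0 ∧
        ∀ i : Fin 4, eval x (map (algebraMap k (AlgebraicClosure k)) (pderiv i f)) = 0) →
      x = 0

namespace CubicLines

section Trilinear

variable {k V : Type*} [CommRing k] [AddCommGroup V] [Module k V]

/-- The cubic form attached to a trilinear form. -/
def cub (T : V →ₗ[k] V →ₗ[k] V →ₗ[k] k) (x : V) : k := T x x x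

/-- The derivative at `x` in the direction `v` of the cubic form attached to `T`. -/
def pol (T : V →ₗ[k] V →ₗ[k] V →ₗ[k] k) (x v : V) : k := T v x x + T x v x + T x x v

/-- The full polarization of the cubic form attached to `T`. -/
def tri (T : V →ₗ[k] V →ₗ[k] V →ₗ[k] k) (x y z : V) : k :=
  T x y z + T x z y + T y x z + T y z x + T z x y + T z y x

end Trilinear

section Representation

variable {k : Type*} [CommRing k]

/-- The trilinear form on `k⁴` with coefficients `c`. -/
def ofCoeff (c : Fin 4 → Fin 4 → Fin 4 → k) :
    (Fin 4 → k) →ₗ[k] (Fin 4 → k) →ₗ[k] (Fin 4 → k) →ₗ[k] k :=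
  ∑ a, ∑ b, ∑ d, c a b d • (LinearMap.proj a : (Fin 4 → k) →ₗ[k] k).smulRight
    ((LinearMap.proj b : (Fin 4 → k) →ₗ[k] k).smulRight (LinearMap.proj d : (Fin 4 → k) →ₗ[k] k))

lemma ofCoeff_apply (c : Fin 4 → Fin 4 → Fin 4 → k) (x y z : Fin 4 → k) :
    ofCoeff c x y z = ∑ a, ∑ b, ∑ d, c a b d * (x a * (y b * z d)) := by
  simp [ofCoeff, LinearMap.sum_apply]

/-- The cubic polynomial with (redundant) coefficients `c`. -/
noncomputable def cubicPoly (c : Fin 4 → Fin 4 → Fin 4 → k) : MvPolynomial (Fin 4) k :=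
  ∑ a, ∑ b, ∑ d, C (c a b d) * (X a * (X b * X d))

lemma exists_single_add {d : Fin 4 →₀ ℕ} {n : ℕ} (hd : d.degree = n + 1) :
    ∃ (a : Fin 4) (e : Fin 4 →₀ ℕ), e.degree = n ∧ d = Finsupp.single a 1 + e := by
  have h0 : d ≠ 0 := by
    rintro rfl
    simp at hd
  obtain ⟨a, ha⟩ := Finsupp.ne_iff.mp h0
  have hle : Finsupp.single a 1 ≤ d := by
    rw [Finsupp.single_le_iff]
    exact Nat.one_le_iff_ne_zero.mpr ha
  refine ⟨a, d - Finsupp.single a 1, ?_, (add_tsub_cancel_of_le hle).symm⟩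
  have := congrArg Finsupp.degree (add_tsub_cancel_of_le hle)
  rw [map_add, Finsupp.degree_single, hd] at this
  omega

lemma exists_cubicPoly_eq {f : MvPolynomial (Fin 4) k} (hf : f.IsHomogeneous 3) :
    ∃ c, f = cubicPoly c := by
  rw [f.as_sum]
  refine Finset.sum_induction _ (fun g => ∃ c, g = cubicPoly c) ?_ ?_ ?_
  · rintro _ _ ⟨c, rfl⟩ ⟨c', rfl⟩
    refine ⟨c + c', ?_⟩
    simp [cubicPoly, add_mul, Finset.sum_add_distrib]
  · exact ⟨0, by simp [cubicPoly]⟩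
  · intro d hd
    have h3 : d.degree = 3 := by
      rw [Finsupp.degree_eq_weight_one (R := ℕ)]
      exact hf (mem_support_iff.mp hd)
    obtain ⟨a, d, h2, rfl⟩ := exists_single_add h3
    obtain ⟨b, d, h1, rfl⟩ := exists_single_add h2
    obtain ⟨e, d, h0, rfl⟩ := exists_single_add h1
    obtain rfl : d = 0 := (Finsupp.degree_eq_zero_iff d).mp h0
    generalize coeff _ f = r
    refine ⟨fun a' b' e' => if a' = a then if b' = b then if e' = e then r else 0 else 0 else 0, ?_⟩
    simp only [cubicPoly, apply_ite C, map_zero, ite_mul, zero_mul, Finset.sum_ite_irrel,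
      Finset.sum_const_zero, Finset.sum_ite_eq', Finset.mem_univ, if_true]
    simp [X, C_mul_monomial, monomial_mul]

lemma lineRestrict_cubicPoly (c : Fin 4 → Fin 4 → Fin 4 → k) (v w : Fin 4 → k) :
    lineRestrict (cubicPoly c) v w =
      C (cub (ofCoeff c) v) * X 0 ^ 3 + C (pol (ofCoeff c) v w) * (X 0 ^ 2 * X 1) +
      C (pol (ofCoeff c) w v) * (X 0 * X 1 ^ 2) + C (cub (ofCoeff c) w) * X 1 ^ 3 := by
  simp only [lineRestrict, cubicPoly, cub, pol, ofCoeff_apply, map_sum, map_add, map_mul,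
    aeval_X, algHom_C, algebraMap_eq, Finset.sum_mul, ← Finset.sum_add_distrib]
  refine Finset.sum_congr rfl fun a _ => Finset.sum_congr rfl fun b _ =>
    Finset.sum_congr rfl fun d _ => ?_
  ring

lemma binaryCubic_eq_zero_iff (p q r s : k) :
    (C p * X 0 ^ 3 + C q * (X 0 ^ 2 * X 1) + C r * (X 0 * X 1 ^ 2) + C s * X 1 ^ 3 :
      MvPolynomial (Fin 2) k) = 0 ↔ p = 0 ∧ q = 0 ∧ r = 0 ∧ s = 0 := by
  constructor
  · intro h
    have h' := congrArg (aeval (![Polynomial.X, 1] : Fin 2 → Polynomial k)) h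
    simp only [map_add, map_mul, algHom_C, map_pow, aeval_X, Matrix.cons_val_zero,
      Matrix.cons_val_one, one_pow, mul_one, map_zero, Polynomial.algebraMap_eq] at h'
    have h3 := congrArg (Polynomial.coeff · 3) h'
    have h2 := congrArg (Polynomial.coeff · 2) h'
    have h1 := congrArg (Polynomial.coeff · 1) h'
    have h0 := congrArg (Polynomial.coeff · 0) h'
    simp [Polynomial.coeff_C, Polynomial.coeff_X, Polynomial.coeff_X_pow] at h0 h1 h2 h3
    exact ⟨h3, h2, h1, h0⟩
  · rintro ⟨rfl, rfl, rfl, rfl⟩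
    simp

lemma lineRestrict_cubicPoly_eq_zero_iff (c : Fin 4 → Fin 4 → Fin 4 → k) (v w : Fin 4 → k) :
    lineRestrict (cubicPoly c) v w = 0 ↔ cub (ofCoeff c) v = 0 ∧ pol (ofCoeff c) v w = 0 ∧
      pol (ofCoeff c) w v = 0 ∧ cub (ofCoeff c) w = 0 := by
  rw [lineRestrict_cubicPoly, binaryCubic_eq_zero_iff]

variable {K : Type*} [CommRing K] [Algebra k K]

lemma ofCoeff_algebraMap (c : Fin 4 → Fin 4 → Fin 4 → k) (x y z : Fin 4 → k) :
    ofCoeff (fun a b d => algebraMap k K (c a b d)) (fun i => algebraMap k K (x i))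
      (fun i => algebraMap k K (y i)) (fun i => algebraMap k K (z i)) =
      algebraMap k K (ofCoeff c x y z) := by
  simp [ofCoeff_apply]

lemma eval_map_cubicPoly (c : Fin 4 → Fin 4 → Fin 4 → k) (x : Fin 4 → K) :
    eval x (map (algebraMap k K) (cubicPoly c)) =
      cub (ofCoeff fun a b d => algebraMap k K (c a b d)) x := by
  simp [cubicPoly, cub, ofCoeff_apply]

lemma eval_map_pderiv_cubicPoly (c : Fin 4 → Fin 4 → Fin 4 → k) (x : Fin 4 → K) (i : Fin 4) :
    eval x (map (algebraMap k K) (pderiv i (cubicPoly c))) =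
      pol (ofCoeff fun a b d => algebraMap k K (c a b d)) x (Pi.single i 1) := by
  simp only [cubicPoly, pol, ofCoeff_apply, map_sum, ← Finset.sum_add_distrib]
  refine Finset.sum_congr rfl fun a _ => Finset.sum_congr rfl fun b _ =>
    Finset.sum_congr rfl fun d _ => ?_
  simp only [Derivation.leibniz, pderiv_C, pderiv_X, smul_eq_mul, map_add, map_mul, map_C, map_X,
    eval_C, eval_X, Pi.single_apply, apply_ite (map (algebraMap k K)), apply_ite (eval x),
    map_one, map_zero, mul_zero, add_zero]
  ring

end Representation

section Smooth

variable {k V : Type*} [Field k] [AddCommGroup V] [Module k V]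

/-- Nonsingularity of the cubic form attached to `T`: it has no singular rational point, and
no singular point, even over an algebraic closure, on a rational line. -/
structure Nonsing (T : V →ₗ[k] V →ₗ[k] V →ₗ[k] k) : Prop where
  point : ∀ x : V, x ≠ 0 → cub T x = 0 → (∀ v, pol T x v = 0) → False
  line : ∀ u : Fin 4 → V, LinearIndependent k u → cub T (u 1) = 0 → cub T (u 2) = 0 →
    (∀ j, j ≠ 0 → pol T (u 1) (u j) = 0 ∧ tri T (u 1) (u 2) (u j) = 0 ∧
      pol T (u 2) (u j) = 0) → False

end Smooth

section Polarization

variable {k V : Type*} [CommRing k] [AddCommGroup V] [Module k V]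
  (T : V →ₗ[k] V →ₗ[k] V →ₗ[k] k)

lemma cub_smul_add_smul (s t : k) (x y : V) : cub T (s • x + t • y) =
    s ^ 3 * cub T x + s ^ 2 * t * pol T x y + s * t ^ 2 * pol T y x + t ^ 3 * cub T y := by
  simp only [cub, pol, map_add, map_smul, LinearMap.add_apply, LinearMap.smul_apply, smul_eq_mul]
  ring

lemma pol_smul_add_smul_left (s t : k) (x y v : V) : pol T (s • x + t • y) v =
    s ^ 2 * pol T x v + s * t * tri T x y v + t ^ 2 * pol T y v := by
  simp only [tri, pol, map_add, map_smul, LinearMap.add_apply, LinearMap.smul_apply, smul_eq_mul]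
  ring

lemma pol_add_right (x v w : V) : pol T x (v + w) = pol T x v + pol T x w := by
  simp only [pol, map_add, LinearMap.add_apply]
  ring

lemma pol_smul_right (x v : V) (r : k) : pol T x (r • v) = r * pol T x v := by
  simp only [pol, map_smul, LinearMap.smul_apply, smul_eq_mul]
  ring

lemma pol_self (x : V) : pol T x x = 3 * cub T x := by
  simp only [pol, cub]
  ring

end Polarization

lemma exists_root_binary_quadratic {K : Type*} [Field K] [IsAlgClosed K] (a b c : K) :
    ∃ s t : K, (s ≠ 0 ∨ t ≠ 0) ∧ s ^ 2 * a + s * t * b + t ^ 2 * c = 0 := by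
  by_cases ha : a = 0
  · exact ⟨1, 0, by simp, by simp [ha]⟩
  · obtain ⟨z, hz⟩ := IsAlgClosed.exists_root
      (Polynomial.C a * Polynomial.X ^ 2 + Polynomial.C b * Polynomial.X + Polynomial.C c)
      (by rw [Polynomial.degree_quadratic ha]; decide)
    refine ⟨z, 1, by simp, ?_⟩
    simp at hz
    linear_combination hz

lemma nonsing_of_isSmoothCubic {k : Type*} [Field k] {c : Fin 4 → Fin 4 → Fin 4 → k}
    (h : IsSmoothCubic k (cubicPoly c)) : Nonsing (ofCoeff c) := by
  obtain ⟨-, -, h⟩ := h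
  set K := AlgebraicClosure k
  set T := ofCoeff fun a b d => algebraMap k K (c a b d) with hT
  have base : ∀ x y z : Fin 4 → k, T (algebraMap k K ∘ x) (algebraMap k K ∘ y)
      (algebraMap k K ∘ z) = algebraMap k K (ofCoeff c x y z) := ofCoeff_algebraMap c
  have cubK : ∀ x : Fin 4 → k, cub T (algebraMap k K ∘ x) = algebraMap k K (cub (ofCoeff c) x) :=
    fun x => base _ _ _
  have polK : ∀ x v : Fin 4 → k, pol T (algebraMap k K ∘ x) (algebraMap k K ∘ v) =
      algebraMap k K (pol (ofCoeff c) x v) := fun x v => by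
    simp only [pol, base, map_add]
  have triK : ∀ x y v : Fin 4 → k, tri T (algebraMap k K ∘ x) (algebraMap k K ∘ y)
      (algebraMap k K ∘ v) = algebraMap k K (tri (ofCoeff c) x y v) := fun x y v => by
    simp only [tri, base, map_add]
  have sing : ∀ (u : Fin 4 → Fin 4 → k), LinearIndependent k u → ∀ x : Fin 4 → K,
      cub T x = 0 → (∀ j, pol T x (algebraMap k K ∘ u j) = 0) → x = 0 := by
    intro u hu x hx hpol
    refine h x ⟨by rw [eval_map_cubicPoly, hx], fun i => ?_⟩
    rw [eval_map_pderiv_cubicPoly]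
    have hspan : (Pi.single i 1 : Fin 4 → k) ∈ Submodule.span k (Set.range u) := by
      rw [hu.span_eq_top_of_card_eq_finrank (by simp)]
      trivial
    have key : ∀ v ∈ Submodule.span k (Set.range u), pol T x (algebraMap k K ∘ v) = 0 := by
      intro v hv
      induction hv using Submodule.span_induction with
      | mem v hv =>
        obtain ⟨j, rfl⟩ := hv
        exact hpol j
      | zero =>
        have : (algebraMap k K ∘ (0 : Fin 4 → k)) = 0 := by ext; simp
        rw [this]
        simp [pol]
      | add v w _ _ hv hw =>
        have : (algebraMap k K ∘ (v + w)) = algebraMap k K ∘ v + algebraMap k K ∘ w := by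
          ext; simp
        rw [this, pol_add_right, hv, hw, add_zero]
      | smul r v _ hv =>
        have : (algebraMap k K ∘ (r • v)) = algebraMap k K r • (algebraMap k K ∘ v) := by
          ext; simp
        rw [this, pol_smul_right, hv, mul_zero]
    convert key _ hspan using 2
    ext j
    simp [Pi.single_apply, apply_ite (algebraMap k K)]
  constructor
  · intro x hx0 hx hpol
    have hx0' := sing (Pi.basisFun k (Fin 4)) (Pi.basisFun k (Fin 4)).linearIndependent
      (algebraMap k K ∘ x) (by rw [cubK, hx, map_zero])
      (fun j => by rw [polK, hpol, map_zero])
    apply hx0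
    ext i
    simpa using congrFun hx0' i
  · intro u hu h0 h1 hj
    obtain ⟨s, t, hst, hroot⟩ := exists_root_binary_quadratic
      (algebraMap k K (pol (ofCoeff c) (u 1) (u 0)))
      (algebraMap k K (tri (ofCoeff c) (u 1) (u 2) (u 0)))
      (algebraMap k K (pol (ofCoeff c) (u 2) (u 0)))
    have hx := sing u hu (s • (algebraMap k K ∘ u 1) + t • (algebraMap k K ∘ u 2))
      (by
        rw [cub_smul_add_smul, cubK, cubK, polK, polK, h0, h1, (hj 2 (by decide)).1,
          (hj 1 (by decide)).2.2]
        simp)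
      (fun j => by
        rw [pol_smul_add_smul_left, polK, polK, triK]
        by_cases h3 : j = 0
        · rw [h3]
          exact hroot
        · rw [(hj j h3).1, (hj j h3).2.1, (hj j h3).2.2]
          simp)
    have hdet : (Matrix.of u).det ≠ 0 := by
      have := (Matrix.linearIndependent_rows_iff_isUnit (A := Matrix.of u)).mp hu
      exact ((Matrix.isUnit_iff_isUnit_det _).mp this).ne_zero
    have hdet' : ((algebraMap k K).mapMatrix (Matrix.of u)).det ≠ 0 := by
      rw [← RingHom.map_det]
      simpa using hdet
    have := Matrix.eq_zero_of_vecMul_eq_zero hdet' (v := ![0, s, t, 0]) (by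
      rw [← hx]
      ext i
      simp [Matrix.vecMul, dotProduct, Fin.sum_univ_four])
    rcases hst with h | h
    · exact h (by simpa using congrFun this 1)
    · exact h (by simpa using congrFun this 2)

section ThreeVectors

variable {k V : Type*} [CommRing k] [AddCommGroup V] [Module k V]
  (T : V →ₗ[k] V →ₗ[k] V →ₗ[k] k)

lemma tri_self_left (x y : V) : tri T x y x = 2 * pol T x y := by
  simp only [tri, pol]
  ring

lemma tri_self_right (x y : V) : tri T x y y = 2 * pol T y x := by
  simp only [tri, pol]
  ring

lemma tri_rotate (x y z : V) : tri T x y z = tri T y z x := by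
  simp only [tri]
  ring

lemma tri_swap (x y z : V) : tri T x y z = tri T y x z := by
  simp only [tri]
  ring

lemma pol_add_left (x y v : V) : pol T (x + y) v = pol T x v + tri T x y v + pol T y v := by
  simp only [tri, pol, map_add, LinearMap.add_apply]
  ring

lemma pol_smul_left (x v : V) (r : k) : pol T (r • x) v = r ^ 2 * pol T x v := by
  simp only [pol, map_smul, LinearMap.smul_apply, smul_eq_mul]
  ring

lemma cub_add (x y : V) : cub T (x + y) = cub T x + pol T x y + pol T y x + cub T y := by
  simp only [cub, pol, map_add, LinearMap.add_apply]
  ring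

lemma cub_smul (x : V) (r : k) : cub T (r • x) = r ^ 3 * cub T x := by
  simp only [cub, map_smul, LinearMap.smul_apply, smul_eq_mul]
  ring

lemma tri_add_right (x y v w : V) : tri T x y (v + w) = tri T x y v + tri T x y w := by
  simp only [tri, map_add, LinearMap.add_apply]
  ring

lemma tri_smul_right (x y v : V) (r : k) : tri T x y (r • v) = r * tri T x y v := by
  simp only [tri, map_smul, LinearMap.smul_apply, smul_eq_mul]
  ring

lemma tri_add_mid (x y v w : V) : tri T x (v + w) y = tri T x v y + tri T x w y := by
  simp only [tri, map_add, LinearMap.add_apply]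
  ring

lemma tri_smul_mid (x y v : V) (r : k) : tri T x (r • v) y = r * tri T x v y := by
  simp only [tri, map_smul, LinearMap.smul_apply, smul_eq_mul]
  ring

lemma cub_three (u₀ u₁ u₂ : V) (x₀ x₁ x₂ : k) : cub T (x₀ • u₀ + x₁ • u₁ + x₂ • u₂) =
    x₀ ^ 3 * cub T u₀ + x₁ ^ 3 * cub T u₁ + x₂ ^ 3 * cub T u₂ +
    x₀ ^ 2 * x₁ * pol T u₀ u₁ + x₀ ^ 2 * x₂ * pol T u₀ u₂ + x₁ ^ 2 * x₀ * pol T u₁ u₀ +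
    x₁ ^ 2 * x₂ * pol T u₁ u₂ + x₂ ^ 2 * x₀ * pol T u₂ u₀ + x₂ ^ 2 * x₁ * pol T u₂ u₁ +
    x₀ * x₁ * x₂ * tri T u₀ u₁ u₂ := by
  simp only [tri, pol, cub, map_add, map_smul, LinearMap.add_apply, LinearMap.smul_apply,
    smul_eq_mul]
  ring

lemma pol_three (u₀ u₁ u₂ : V) (x₀ x₁ x₂ y₀ y₁ y₂ : k) :
    pol T (x₀ • u₀ + x₁ • u₁ + x₂ • u₂) (y₀ • u₀ + y₁ • u₁ + y₂ • u₂) =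
    3 * x₀ ^ 2 * y₀ * cub T u₀ + 3 * x₁ ^ 2 * y₁ * cub T u₁ + 3 * x₂ ^ 2 * y₂ * cub T u₂ +
    (2 * x₀ * y₀ * x₁ + x₀ ^ 2 * y₁) * pol T u₀ u₁ +
    (2 * x₀ * y₀ * x₂ + x₀ ^ 2 * y₂) * pol T u₀ u₂ +
    (2 * x₁ * y₁ * x₀ + x₁ ^ 2 * y₀) * pol T u₁ u₀ +
    (2 * x₁ * y₁ * x₂ + x₁ ^ 2 * y₂) * pol T u₁ u₂ +
    (2 * x₂ * y₂ * x₀ + x₂ ^ 2 * y₀) * pol T u₂ u₀ +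
    (2 * x₂ * y₂ * x₁ + x₂ ^ 2 * y₁) * pol T u₂ u₁ +
    (y₀ * x₁ * x₂ + x₀ * y₁ * x₂ + x₀ * x₁ * y₂) * tri T u₀ u₁ u₂ := by
  simp only [tri, pol, cub, map_add, map_smul, LinearMap.add_apply, LinearMap.smul_apply,
    smul_eq_mul]
  ring

end ThreeVectors

section Lines

variable {k V : Type*} [Field k] [AddCommGroup V] [Module k V]

lemma span_pair_eq {W : Submodule k V} (hW : Module.finrank k W = 2) {x y : V} (hx : x ∈ W)
    (hy : y ∈ W) (h : LinearIndependent k ![x, y]) : Submodule.span k {x, y} = W := by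
  have : FiniteDimensional k W := Module.finite_of_finrank_eq_succ hW
  apply Submodule.eq_of_le_of_finrank_eq
  · rw [Submodule.span_le]
    rintro z (rfl | rfl)
    · exact hx
    · exact hy
  · have := finrank_span_eq_card h
    rw [Matrix.range_cons, Matrix.range_cons, Matrix.range_empty, Set.union_empty,
      Set.singleton_union] at this
    rw [this, hW]
    rfl

lemma finrank_span_pair {x y : V} (h : LinearIndependent k ![x, y]) :
    Module.finrank k (Submodule.span k {x, y}) = 2 := by
  have := finrank_span_eq_card h
  rwa [Matrix.range_cons, Matrix.range_cons, Matrix.range_empty, Set.union_empty,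
    Set.singleton_union] at this

lemma exists_second {W : Submodule k V} (hW : Module.finrank k W = 2) {x : V} (hx : x ≠ 0) :
    ∃ y ∈ W, LinearIndependent k ![x, y] := by
  have : FiniteDimensional k W := Module.finite_of_finrank_eq_succ hW
  by_contra! hcon
  have hle : W ≤ Submodule.span k {x} := by
    intro y hy
    have := hcon y hy
    rw [LinearIndependent.pair_iff' hx] at this
    push Not at this
    obtain ⟨a, rfl⟩ := this
    exact Submodule.smul_mem _ _ (Submodule.mem_span_singleton_self x)
  have := Submodule.finrank_mono hle
  rw [hW, finrank_span_singleton hx] at this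
  omega

lemma eq_of_le_of_finrank_two {W W' : Submodule k V} (hW : Module.finrank k W = 2)
    (hW' : Module.finrank k W' = 2) (h : W ≤ W') : W = W' := by
  have : FiniteDimensional k W' := Module.finite_of_finrank_eq_succ hW'
  exact Submodule.eq_of_le_of_finrank_eq h (hW.trans hW'.symm)

/-- `W` is a line on the cubic attached to `T`. -/
structure IsL (T : V →ₗ[k] V →ₗ[k] V →ₗ[k] k) (W : Submodule k V) : Prop where
  finrank_eq : Module.finrank k W = 2
  cub_eq : ∀ x ∈ W, cub T x = 0
  pol_eq : ∀ x ∈ W, ∀ y ∈ W, pol T x y = 0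

variable {T : V →ₗ[k] V →ₗ[k] V →ₗ[k] k}

lemma isL_span_pair {x y : V} (h : LinearIndependent k ![x, y]) (hx : cub T x = 0)
    (hxy : pol T x y = 0) (hyx : pol T y x = 0) (hy : cub T y = 0) :
    IsL T (Submodule.span k {x, y}) := by
  refine ⟨finrank_span_pair h, ?_, ?_⟩
  · intro z hz
    obtain ⟨a, b, rfl⟩ := Submodule.mem_span_pair.mp hz
    rw [cub_smul_add_smul, hx, hxy, hyx, hy]
    ring
  · intro z hz w hw
    obtain ⟨a, b, rfl⟩ := Submodule.mem_span_pair.mp hz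
    obtain ⟨c, d, rfl⟩ := Submodule.mem_span_pair.mp hw
    rw [pol_smul_add_smul_left, pol_add_right, pol_add_right, tri_add_right]
    simp only [pol_smul_right, tri_smul_right, pol_self, tri_self_left, tri_self_right, hx, hxy,
      hyx, hy]
    ring

lemma isLineOn_cubicPoly_iff (c : Fin 4 → Fin 4 → Fin 4 → k) (W : Submodule k (Fin 4 → k)) :
    IsLineOn (cubicPoly c) W ↔ IsL (ofCoeff c) W := by
  constructor
  · rintro ⟨h2, v, w, rfl, h⟩
    rw [lineRestrict_cubicPoly_eq_zero_iff] at h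
    refine isL_span_pair ?_ h.1 h.2.1 h.2.2.1 h.2.2.2
    rw [linearIndependent_iff_card_eq_finrank_span, Set.finrank, Matrix.range_cons,
      Matrix.range_cons, Matrix.range_empty, Set.union_empty, Set.singleton_union, h2]
    rfl
  · intro h
    have h2 := h.finrank_eq
    obtain ⟨x, hx, hx0⟩ := W.exists_mem_ne_zero_of_ne_bot (by
      rintro rfl
      simp at h2)
    obtain ⟨y, hy, hxy⟩ := exists_second h2 hx0
    refine ⟨h2, x, y, span_pair_eq h2 hx hy hxy, ?_⟩
    rw [lineRestrict_cubicPoly_eq_zero_iff]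
    exact ⟨h.cub_eq _ hx, h.pol_eq _ hx _ hy, h.pol_eq _ hy _ hx, h.cub_eq _ hy⟩

end Lines

section Triangles

variable {k V : Type*} [Field k] [AddCommGroup V] [Module k V]
  {T : V →ₗ[k] V →ₗ[k] V →ₗ[k] k}

lemma linearIndependent_triple {x y z : V} (h : LinearIndependent k ![y, z])
    (hx : x ∉ Submodule.span k {y, z}) : LinearIndependent k ![x, y, z] := by
  refine linearIndependent_finCons.mpr ⟨h, ?_⟩
  rwa [Matrix.range_cons, Matrix.range_cons, Matrix.range_empty, Set.union_empty,
    Set.singleton_union]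

lemma Nonsing.plane (hN : Nonsing T) (hV : Module.finrank k V = 4) {p q r : V}
    (h : LinearIndependent k ![r, p, q]) (hp : cub T p = 0) (hpq : pol T p q = 0)
    (hqp : pol T q p = 0) (hq : cub T q = 0) (hpr : pol T p r = 0) (hqr : pol T q r = 0)
    (hpqr : tri T p q r = 0) : False := by
  have : FiniteDimensional k V := Module.finite_of_finrank_eq_succ hV
  obtain ⟨s, hs⟩ : ∃ s, s ∉ Submodule.span k (Set.range ![r, p, q]) := by
    by_contra! hcon
    have := finrank_span_eq_card h
    rw [(Submodule.eq_top_iff'.mpr hcon), finrank_top, hV] at this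
    simp at this
  have h4 : LinearIndependent k ![s, r, p, q] := linearIndependent_finCons.mpr ⟨h, hs⟩
  have h4' : LinearIndependent k ![s, p, q, r] := by
    have := h4.comp ![0, 2, 3, 1] (by decide)
    convert this using 1
    ext i
    fin_cases i <;> rfl
  refine hN.line _ h4' hp hq fun j hj => ?_
  fin_cases j
  · exact absurd rfl hj
  · simp [pol_self, tri_self_left, *]
  · simp [pol_self, tri_self_right, *]
  · simp [*]

/-- `pol T x` as a linear form. -/
def polHom (T : V →ₗ[k] V →ₗ[k] V →ₗ[k] k) (x : V) : V →ₗ[k] k where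
  toFun := pol T x
  map_add' := pol_add_right T x
  map_smul' r v := pol_smul_right T x v r

lemma finrank_sup_eq_three {a b : Submodule k V} (ha : Module.finrank k a = 2)
    (hb : Module.finrank k b = 2) (hab : a ≠ b) (hm : a ⊓ b ≠ ⊥) :
    Module.finrank k ↥(a ⊔ b) = 3 := by
  have : FiniteDimensional k a := Module.finite_of_finrank_eq_succ ha
  have : FiniteDimensional k b := Module.finite_of_finrank_eq_succ hb
  have h := Submodule.finrank_sup_add_finrank_inf_eq a b
  have h1 : 1 ≤ Module.finrank k ↥(a ⊓ b) := Submodule.one_le_finrank_iff.mpr hm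
  have h2 : a < a ⊔ b := by
    refine left_lt_sup.mpr fun hle => hab ?_
    exact (eq_of_le_of_finrank_two hb ha hle).symm
  have := Submodule.finrank_lt_finrank_of_lt h2
  omega

lemma IsL.le_sup (hN : Nonsing T) (hV : Module.finrank k V = 4) {a b d : Submodule k V}
    (ha : IsL T a) (hb : IsL T b) (hd : IsL T d) (hab : a ≠ b) (hm : a ⊓ b ≠ ⊥)
    (hda : d ⊓ a ≠ ⊥) (hdb : d ⊓ b ≠ ⊥) : d ≤ a ⊔ b := by
  have : FiniteDimensional k V := Module.finite_of_finrank_eq_succ hV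
  obtain ⟨p, ⟨hpd, hpa⟩, hp0⟩ := Submodule.exists_mem_ne_zero_of_ne_bot hda
  obtain ⟨q, ⟨hqd, hqb⟩, hq0⟩ := Submodule.exists_mem_ne_zero_of_ne_bot hdb
  by_cases h : LinearIndependent k ![p, q]
  · rw [← span_pair_eq hd.finrank_eq hpd hqd h, Submodule.span_le]
    rintro z (rfl | rfl)
    · exact Submodule.mem_sup_left hpa
    · exact Submodule.mem_sup_right hqb
  · rw [LinearIndependent.pair_iff' hp0] at h
    push Not at h
    obtain ⟨r, rfl⟩ := h
    have hpb : p ∈ b := (b.smul_mem_iff fun h0 => hq0 (by simp [h0])).mp hqb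
    by_contra hle
    have hker : ∀ W, IsL T W → p ∈ W → W ≤ LinearMap.ker (polHom T p) := fun W hW hpW x hx =>
      hW.pol_eq _ hpW _ hx
    have hlt : a ⊔ b < a ⊔ b ⊔ d := left_lt_sup.mpr hle
    have h3 := finrank_sup_eq_three ha.finrank_eq hb.finrank_eq hab hm
    have h4 := Submodule.finrank_lt_finrank_of_lt hlt
    have htop : a ⊔ b ⊔ d = ⊤ := by
      apply Submodule.eq_top_of_finrank_eq
      have := Submodule.finrank_le (a ⊔ b ⊔ d)
      omega
    have hle' : a ⊔ b ⊔ d ≤ LinearMap.ker (polHom T p) :=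
      sup_le (sup_le (hker a ha hpa) (hker b hb hpb)) (hker d hd hpd)
    rw [htop] at hle'
    exact hN.point p hp0 (ha.cub_eq p hpa) fun v => hle' (Submodule.mem_top (x := v))

lemma inf_ne_bot_of_finrank {n : ℕ} {a b : Submodule k V} [FiniteDimensional k V]
    (h : Module.finrank k ↥(a ⊔ b) ≤ n) (hlt : n < Module.finrank k a + Module.finrank k b) :
    a ⊓ b ≠ ⊥ := by
  intro hbot
  have h := Submodule.finrank_sup_add_finrank_inf_eq a b
  rw [hbot, finrank_bot] at h
  omega

/-- Two distinct meeting lines on a nonsingular cubic surface lie on a plane cutting the surface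
in three distinct lines. -/
lemma IsL.exists_third (hN : Nonsing T) (hV : Module.finrank k V = 4) {a b : Submodule k V}
    (ha : IsL T a) (hb : IsL T b) (hab : a ≠ b) (hm : a ⊓ b ≠ ⊥) :
    ∃ c, IsL T c ∧ c ≠ a ∧ c ≠ b ∧ a ⊓ c ≠ ⊥ ∧ b ⊓ c ≠ ⊥ ∧ c ≤ a ⊔ b ∧
      (∀ d, IsL T d → d ≤ a ⊔ b → d = a ∨ d = b ∨ d = c) ∧
      ∀ v ∈ a ⊔ b, cub T v = 0 → v ∈ a ∨ v ∈ b ∨ v ∈ c := by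
  have : FiniteDimensional k V := Module.finite_of_finrank_eq_succ hV
  obtain ⟨u₀, ⟨h0a, h0b⟩, hu0⟩ := Submodule.exists_mem_ne_zero_of_ne_bot hm
  obtain ⟨u₁, h1a, h01⟩ := exists_second ha.finrank_eq hu0
  obtain ⟨u₂, h2b, h02⟩ := exists_second hb.finrank_eq hu0
  have hspa := span_pair_eq ha.finrank_eq h0a h1a h01
  have hspb := span_pair_eq hb.finrank_eq h0b h2b h02
  have h2a : u₂ ∉ a := fun h => hab (by rw [← hspb, span_pair_eq ha.finrank_eq h0a h h02])
  have h1b : u₁ ∉ b := fun h => hab (by rw [← hspa, span_pair_eq hb.finrank_eq h0b h h01])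
  have hli := linearIndependent_triple h01 (by rwa [hspa])
  have hli' := linearIndependent_triple h02 (by rwa [hspb])
  have hinj : ∀ x₀ x₁ x₂ : k, x₀ • u₀ + x₁ • u₁ + x₂ • u₂ = 0 → x₀ = 0 ∧ x₁ = 0 ∧ x₂ = 0 := by
    intro x₀ x₁ x₂ h
    have := Fintype.linearIndependent_iff.mp hli ![x₂, x₀, x₁] (by
      rw [← h]
      simp [Fin.sum_univ_three]
      abel)
    exact ⟨this 1, this 2, this 0⟩
  set α := tri T u₀ u₁ u₂ with hα
  set β := pol T u₁ u₂ with hβ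
  set γ := pol T u₂ u₁ with hγ
  have hcub : ∀ x₀ x₁ x₂ : k, cub T (x₀ • u₀ + x₁ • u₁ + x₂ • u₂) =
      x₁ * x₂ * (α * x₀ + β * x₁ + γ * x₂) := by
    intro x₀ x₁ x₂
    rw [cub_three, ha.cub_eq _ h0a, ha.cub_eq _ h1a, hb.cub_eq _ h2b, ha.pol_eq _ h0a _ h1a,
      ha.pol_eq _ h1a _ h0a, hb.pol_eq _ h0b _ h2b, hb.pol_eq _ h2b _ h0b]
    ring
  have hpol : ∀ x₀ x₁ x₂ y₀ y₁ y₂ : k,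
      pol T (x₀ • u₀ + x₁ • u₁ + x₂ • u₂) (y₀ • u₀ + y₁ • u₁ + y₂ • u₂) =
      (y₁ * x₂ + x₁ * y₂) * (α * x₀ + β * x₁ + γ * x₂) +
        x₁ * x₂ * (α * y₀ + β * y₁ + γ * y₂) := by
    intro x₀ x₁ x₂ y₀ y₁ y₂
    rw [pol_three, ha.cub_eq _ h0a, ha.cub_eq _ h1a, hb.cub_eq _ h2b, ha.pol_eq _ h0a _ h1a,
      ha.pol_eq _ h1a _ h0a, hb.pol_eq _ h0b _ h2b, hb.pol_eq _ h2b _ h0b]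
    ring
  have hαβ : ¬(α = 0 ∧ β = 0) := fun ⟨h, h'⟩ =>
    hN.plane hV hli (ha.cub_eq _ h0a) (ha.pol_eq _ h0a _ h1a) (ha.pol_eq _ h1a _ h0a)
      (ha.cub_eq _ h1a) (hb.pol_eq _ h0b _ h2b) h' h
  have hαγ : ¬(α = 0 ∧ γ = 0) := fun ⟨h, h'⟩ =>
    hN.plane hV hli' (hb.cub_eq _ h0b) (hb.pol_eq _ h0b _ h2b) (hb.pol_eq _ h2b _ h0b)
      (hb.cub_eq _ h2b) (ha.pol_eq _ h0a _ h1a) h'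
      (by
        rw [← h, hα, tri_swap, tri_rotate])
  have hmem : ∀ v ∈ a ⊔ b, ∃ x₀ x₁ x₂ : k, v = x₀ • u₀ + x₁ • u₁ + x₂ • u₂ := by
    intro v hv
    obtain ⟨y, hy, z, hz, rfl⟩ := Submodule.mem_sup.mp hv
    rw [← hspa] at hy
    rw [← hspb] at hz
    obtain ⟨s, t, rfl⟩ := Submodule.mem_span_pair.mp hy
    obtain ⟨s', t', rfl⟩ := Submodule.mem_span_pair.mp hz
    exact ⟨s + s', t, t', by module⟩
  let Φ : (Fin 3 → k) →ₗ[k] V := Fintype.linearCombination k ![u₀, u₁, u₂]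
  have hΦ : ∀ x, Φ x = x 0 • u₀ + x 1 • u₁ + x 2 • u₂ := fun x => by
    simp [Φ, Fintype.linearCombination_apply, Fin.sum_univ_three]
  have hΦinj : Function.Injective Φ := by
    rw [injective_iff_map_eq_zero]
    intro x hx
    rw [hΦ] at hx
    obtain ⟨h0, h1, h2⟩ := hinj _ _ _ hx
    ext i
    fin_cases i <;> assumption
  let l : Module.Dual k (Fin 3 → k) :=
    α • LinearMap.proj 0 + β • LinearMap.proj 1 + γ • LinearMap.proj 2
  have hl : ∀ x, l x = α * x 0 + β * x 1 + γ * x 2 := fun x => by simp [l]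
  have hl0 : l ≠ 0 := by
    intro h
    refine hαβ ⟨?_, ?_⟩
    · simpa [hl] using DFunLike.congr_fun h (Pi.single 0 1)
    · simpa [hl] using DFunLike.congr_fun h (Pi.single 1 1)
  set c : Submodule k V := (LinearMap.ker l).map Φ with hc
  have hmemc : ∀ x₀ x₁ x₂ : k, α * x₀ + β * x₁ + γ * x₂ = 0 →
      x₀ • u₀ + x₁ • u₁ + x₂ • u₂ ∈ c := fun x₀ x₁ x₂ h =>
    ⟨![x₀, x₁, x₂], by simpa [hl] using h, by simp [hΦ]⟩
  have hofc : ∀ v ∈ c, ∃ x₀ x₁ x₂ : k, v = x₀ • u₀ + x₁ • u₁ + x₂ • u₂ ∧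
      α * x₀ + β * x₁ + γ * x₂ = 0 := by
    rintro _ ⟨x, hx, rfl⟩
    exact ⟨x 0, x 1, x 2, hΦ x, by rw [← hl]; exact hx⟩
  have hcL : IsL T c := by
    refine ⟨?_, ?_, ?_⟩
    · have h := Module.Dual.finrank_ker_add_one_of_ne_zero hl0
      rw [(Submodule.equivMapOfInjective Φ hΦinj _).finrank_eq.symm]
      simpa using h
    · intro v hv
      obtain ⟨x₀, x₁, x₂, rfl, h⟩ := hofc v hv
      rw [hcub, h, mul_zero]
    · intro v hv w hw
      obtain ⟨x₀, x₁, x₂, rfl, h⟩ := hofc v hv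
      obtain ⟨y₀, y₁, y₂, rfl, h'⟩ := hofc w hw
      rw [hpol, h, h', mul_zero, mul_zero, add_zero]
  have hcoef : ∀ {x₀ x₁ x₂ : k}, x₀ • u₀ + x₁ • u₁ + x₂ • u₂ ∈ c →
      α * x₀ + β * x₁ + γ * x₂ = 0 := by
    intro x₀ x₁ x₂ h
    obtain ⟨y₀, y₁, y₂, h, h'⟩ := hofc _ h
    obtain ⟨e0, e1, e2⟩ := hinj (x₀ - y₀) (x₁ - y₁) (x₂ - y₂) (by
      rw [show (x₀ - y₀) • u₀ + (x₁ - y₁) • u₁ + (x₂ - y₂) • u₂ =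
        x₀ • u₀ + x₁ • u₁ + x₂ • u₂ - (y₀ • u₀ + y₁ • u₁ + y₂ • u₂) by module, h, sub_self])
    rw [sub_eq_zero] at e0 e1 e2
    rw [e0, e1, e2, h']
  have hcab : c ≤ a ⊔ b := by
    intro v hv
    obtain ⟨x₀, x₁, x₂, rfl, -⟩ := hofc v hv
    exact add_mem (Submodule.mem_sup_left (a.add_mem (a.smul_mem _ h0a) (a.smul_mem _ h1a)))
      (Submodule.mem_sup_right (b.smul_mem _ h2b))
  have hamem : ∀ x₀ x₁ : k, x₀ • u₀ + x₁ • u₁ + (0 : k) • u₂ ∈ a := fun x₀ x₁ => by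
    rw [zero_smul, add_zero]
    exact a.add_mem (a.smul_mem _ h0a) (a.smul_mem _ h1a)
  have hbmem : ∀ x₀ x₂ : k, x₀ • u₀ + (0 : k) • u₁ + x₂ • u₂ ∈ b := fun x₀ x₂ => by
    rw [zero_smul, add_zero]
    exact b.add_mem (b.smul_mem _ h0b) (b.smul_mem _ h2b)
  refine ⟨c, hcL, ?_, ?_, ?_, ?_, hcab, ?_, ?_⟩
  · intro h
    refine hαβ ⟨?_, ?_⟩
    · simpa using hcoef (x₀ := 1) (x₁ := 0) (x₂ := 0) (h ▸ hamem 1 0)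
    · simpa using hcoef (x₀ := 0) (x₁ := 1) (x₂ := 0) (h ▸ hamem 0 1)
  · intro h
    refine hαγ ⟨?_, ?_⟩
    · simpa using hcoef (x₀ := 1) (x₁ := 0) (x₂ := 0) (h ▸ hbmem 1 0)
    · simpa using hcoef (x₀ := 0) (x₁ := 0) (x₂ := 1) (h ▸ hbmem 0 1)
  · refine Submodule.ne_bot_iff _ |>.mpr ⟨(-β) • u₀ + α • u₁ + (0 : k) • u₂,
      ⟨hamem _ _, hmemc _ _ _ (by ring)⟩, fun h => ?_⟩
    obtain ⟨h0, h1, -⟩ := hinj _ _ _ h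
    exact hαβ ⟨h1, neg_eq_zero.mp h0⟩
  · refine Submodule.ne_bot_iff _ |>.mpr ⟨(-γ) • u₀ + (0 : k) • u₁ + α • u₂,
      ⟨hbmem _ _, hmemc _ _ _ (by ring)⟩, fun h => ?_⟩
    obtain ⟨h0, -, h1⟩ := hinj _ _ _ h
    exact hαγ ⟨h1, neg_eq_zero.mp h0⟩
  · intro d hd hdle
    by_contra! hcon
    obtain ⟨hda, hdb, hdc⟩ := hcon
    have h3 := finrank_sup_eq_three ha.finrank_eq hb.finrank_eq hab hm
    have hmeet : ∀ e ≤ a ⊔ b, IsL T e → ∃ x ∈ d, x ∈ e ∧ x ≠ 0 := by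
      intro e he heL
      have hle : Module.finrank k ↥(d ⊔ e) ≤ 3 := h3 ▸ Submodule.finrank_mono (sup_le hdle he)
      obtain ⟨x, ⟨hx, hx'⟩, h⟩ := Submodule.exists_mem_ne_zero_of_ne_bot
        (inf_ne_bot_of_finrank hle (by rw [hd.finrank_eq, heL.finrank_eq]; norm_num))
      exact ⟨x, hx, hx', h⟩
    have hdne : ∀ {x y : V}, x ∈ d → y ∈ d → LinearIndependent k ![x, y] →
        ∀ e, IsL T e → d ≠ e → x ∈ e → y ∈ e → False := by
      intro x y hx hy hxy e he hne hxe hye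
      exact hne (by
        rw [← span_pair_eq hd.finrank_eq hx hy hxy, span_pair_eq he.finrank_eq hxe hye hxy])
    by_cases h0d : u₀ ∈ d
    · obtain ⟨y, hyd, h0y⟩ := exists_second hd.finrank_eq hu0
      obtain ⟨y₀, y₁, y₂, rfl⟩ := hmem y (hdle hyd)
      have hy1 : y₁ ≠ 0 := by
        rintro rfl
        exact hdne h0d hyd h0y b hb hdb h0b (hbmem _ _)
      have hy2 : y₂ ≠ 0 := by
        rintro rfl
        exact hdne h0d hyd h0y a ha hda h0a (hamem _ _)
      have hα0 : α = 0 := by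
        have h := hpol y₀ y₁ y₂ 1 0 0
        rw [show (1 : k) • u₀ + (0 : k) • u₁ + (0 : k) • u₂ = u₀ by simp,
          hd.pol_eq _ hyd _ h0d] at h
        have : y₁ * y₂ * α = 0 := by linear_combination -h
        simpa [hy1, hy2] using this
      have hy := hd.cub_eq _ hyd
      rw [hcub] at hy
      refine hdne h0d hyd h0y c hcL hdc ?_ (hmemc _ _ _ (by simpa [hy1, hy2] using hy))
      have := hmemc 1 0 0 (by simp [hα0])
      simpa using this
    · obtain ⟨v, hvd, hva, hv0⟩ := hmeet a le_sup_left ha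
      obtain ⟨w, hwd, hwb, hw0⟩ := hmeet b le_sup_right hb
      rw [← hspa] at hva
      rw [← hspb] at hwb
      obtain ⟨x₀, x₁, rfl⟩ := Submodule.mem_span_pair.mp hva
      obtain ⟨y₀, y₂, rfl⟩ := Submodule.mem_span_pair.mp hwb
      have hx1 : x₁ ≠ 0 := by
        rintro rfl
        rw [zero_smul, add_zero] at hvd hv0
        exact h0d ((d.smul_mem_iff fun h => hv0 (by simp [h])).mp hvd)
      have hy2 : y₂ ≠ 0 := by
        rintro rfl
        rw [zero_smul, add_zero] at hwd hw0
        exact h0d ((d.smul_mem_iff fun h => hw0 (by simp [h])).mp hwd)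
      have ev : x₀ • u₀ + x₁ • u₁ = x₀ • u₀ + x₁ • u₁ + (0 : k) • u₂ := by simp
      have ew : y₀ • u₀ + y₂ • u₂ = y₀ • u₀ + (0 : k) • u₁ + y₂ • u₂ := by simp
      have hvw := hd.pol_eq _ hvd _ hwd
      have hwv := hd.pol_eq _ hwd _ hvd
      rw [ev, ew, hpol] at hvw hwv
      have hvw' : x₁ * y₂ * (α * x₀ + β * x₁ + γ * 0) = 0 := by linear_combination hvw
      have hwv' : x₁ * y₂ * (α * y₀ + β * 0 + γ * y₂) = 0 := by linear_combination hwv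
      refine hdne hvd hwd ?_ c hcL hdc ?_ ?_
      · rw [LinearIndependent.pair_iff]
        intro s t hst
        obtain ⟨-, h1, h2⟩ := hinj (s * x₀ + t * y₀) (s * x₁) (t * y₂) (by
          rw [← hst]
          module)
        exact ⟨(mul_eq_zero.mp h1).resolve_right hx1, (mul_eq_zero.mp h2).resolve_right hy2⟩
      · rw [ev]
        exact hmemc _ _ _ (by simpa [hx1, hy2] using hvw')
      · rw [ew]
        exact hmemc _ _ _ (by simpa [hx1, hy2] using hwv')
  · intro v hv hv0
    obtain ⟨x₀, x₁, x₂, rfl⟩ := hmem v hv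
    rw [hcub] at hv0
    rcases mul_eq_zero.mp hv0 with h | h
    · rcases mul_eq_zero.mp h with rfl | rfl
      · exact Or.inr (Or.inl (hbmem _ _))
      · exact Or.inl (hamem _ _)
    · exact Or.inr (Or.inr (hmemc _ _ _ h))

end Triangles

section SkewLines

variable {k V : Type*} [Field k] [AddCommGroup V] [Module k V]
  {T : V →ₗ[k] V →ₗ[k] V →ₗ[k] k}

lemma eq_zero_of_inf_eq_bot {a b : Submodule k V} (h : a ⊓ b = ⊥) {x : V} (ha : x ∈ a)
    (hb : x ∈ b) : x = 0 :=
  (Submodule.mem_bot k).mp (h ▸ Submodule.mem_inf.mpr ⟨ha, hb⟩)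

lemma sup_eq_top_of_inf_eq_bot (hV : Module.finrank k V = 4) {a b : Submodule k V}
    (ha : Module.finrank k a = 2) (hb : Module.finrank k b = 2) (h : a ⊓ b = ⊥) : a ⊔ b = ⊤ := by
  have : FiniteDimensional k V := Module.finite_of_finrank_eq_succ hV
  apply Submodule.eq_top_of_finrank_eq
  have := Submodule.finrank_sup_add_finrank_inf_eq a b
  rw [h, finrank_bot] at this
  omega

/-- Three pairwise skew lines on the cubic attached to `T`. -/
structure SkewTriple (T : V →ₗ[k] V →ₗ[k] V →ₗ[k] k) (a b c : Submodule k V) : Prop where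
  left : IsL T a
  mid : IsL T b
  right : IsL T c
  left_mid : a ⊓ b = ⊥
  left_right : a ⊓ c = ⊥
  mid_right : b ⊓ c = ⊥

/-- The linear correspondence between `a` and `b` whose negative has graph `c`. -/
structure Corr (a b c : Submodule k V) (x y : V) : Prop where
  mem_left : x ∈ a
  mem_right : y ∈ b
  add_mem : x + y ∈ c

variable {a b c : Submodule k V} {x y x' y' : V}

lemma Corr.lin (h : Corr a b c x y) (h' : Corr a b c x' y') (s t : k) :
    Corr a b c (s • x + t • x') (s • y + t • y') where
  mem_left := a.add_mem (a.smul_mem _ h.mem_left) (a.smul_mem _ h'.mem_left)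
  mem_right := b.add_mem (b.smul_mem _ h.mem_right) (b.smul_mem _ h'.mem_right)
  add_mem := by
    rw [show s • x + t • x' + (s • y + t • y') = s • (x + y) + t • (x' + y') by module]
    exact c.add_mem (c.smul_mem _ h.add_mem) (c.smul_mem _ h'.add_mem)

lemma Corr.smul (h : Corr a b c x y) (s : k) : Corr a b c (s • x) (s • y) where
  mem_left := a.smul_mem _ h.mem_left
  mem_right := b.smul_mem _ h.mem_right
  add_mem := smul_add s x y ▸ c.smul_mem _ h.add_mem

lemma SkewTriple.exists_corr (hV : Module.finrank k V = 4) (h : SkewTriple T a b c)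
    (hx : x ∈ a) : ∃ y, Corr a b c x y := by
  have htop := sup_eq_top_of_inf_eq_bot hV h.mid.finrank_eq h.right.finrank_eq h.mid_right
  obtain ⟨y, hy, z, hz, rfl⟩ := Submodule.mem_sup.mp (htop ▸ Submodule.mem_top (x := x))
  exact ⟨-y, hx, b.neg_mem hy, by simpa using hz⟩

lemma SkewTriple.swap (h : SkewTriple T a b c) : SkewTriple T b a c where
  left := h.mid
  mid := h.left
  right := h.right
  left_mid := inf_comm a b ▸ h.left_mid
  left_right := h.mid_right
  mid_right := h.left_right

lemma Corr.swap (h : Corr a b c x y) : Corr b a c y x :=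
  ⟨h.mem_right, h.mem_left, add_comm x y ▸ h.add_mem⟩

lemma SkewTriple.corr_unique (h : SkewTriple T a b c) (h₁ : Corr a b c x y)
    (h₂ : Corr a b c x y') : y = y' := by
  have := c.sub_mem h₁.add_mem h₂.add_mem
  rw [add_sub_add_left_eq_sub] at this
  exact sub_eq_zero.mp
    (eq_zero_of_inf_eq_bot h.mid_right (b.sub_mem h₁.mem_right h₂.mem_right) this)

lemma SkewTriple.corr_ne_zero (h : SkewTriple T a b c) (h₁ : Corr a b c x y) (hx : x ≠ 0) :
    y ≠ 0 := by
  rintro rfl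
  have := h₁.add_mem
  rw [add_zero] at this
  exact hx (eq_zero_of_inf_eq_bot h.left_right h₁.mem_left this)

lemma SkewTriple.corr_linearIndependent (h : SkewTriple T a b c) (h₁ : Corr a b c x y)
    (hx : x ≠ 0) : LinearIndependent k ![x, y] := by
  rw [LinearIndependent.pair_iff' hx]
  rintro r rfl
  exact h.corr_ne_zero h₁ hx
    (eq_zero_of_inf_eq_bot h.left_mid (a.smul_mem _ h₁.mem_left) h₁.mem_right)

lemma SkewTriple.linearIndependent_left (h : SkewTriple T a b c) (h₁ : Corr a b c x y)
    (h₂ : Corr a b c x' y') (hli : LinearIndependent k ![y, y']) :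
    LinearIndependent k ![x, x'] := by
  rw [LinearIndependent.pair_iff] at hli ⊢
  intro s t hst
  refine hli s t ?_
  by_contra hne
  exact h.swap.corr_ne_zero (h₁.lin h₂ s t).swap hne hst

lemma SkewTriple.pol_eq_neg (h : SkewTriple T a b c) (h₁ : Corr a b c x y) :
    pol T y x = -pol T x y := by
  have := h.right.cub_eq _ h₁.add_mem
  rw [cub_add, h.left.cub_eq _ h₁.mem_left, h.mid.cub_eq _ h₁.mem_right] at this
  linear_combination this

lemma SkewTriple.pol_add_tri_eq (h : SkewTriple T a b c) (h₁ : Corr a b c x y)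
    (h₂ : Corr a b c x' y') :
    pol T y x' + tri T x y y' = -(pol T x y' + tri T x x' y) := by
  have := h.right.pol_eq _ h₁.add_mem _ h₂.add_mem
  rw [pol_add_left, pol_add_right, pol_add_right, tri_add_right,
    h.left.pol_eq _ h₁.mem_left _ h₂.mem_left, h.mid.pol_eq _ h₁.mem_right _ h₂.mem_right,
    tri_swap T x y x', tri_rotate T y x x'] at this
  linear_combination this

/-- The binary cubic `x ↦ pol T x y` on the correspondence has no double root. -/
lemma SkewTriple.no_double_root (hN : Nonsing T) (hV : Module.finrank k V = 4)
    (h : SkewTriple T a b c) (h₁ : Corr a b c x y) (h₂ : Corr a b c x' y')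
    (hli : LinearIndependent k ![x, x']) (h0 : pol T x y = 0)
    (h0' : pol T x y' + tri T x x' y = 0) : False := by
  have hx : x ≠ 0 := hli.ne_zero 0
  have hxy := LinearIndependent.pair_iff.mp (h.corr_linearIndependent h₁ hx)
  have hli' : LinearIndependent k ![y, y'] :=
    h.swap.linearIndependent_left h₁.swap h₂.swap hli
  have e1 := h.pol_eq_neg h₁
  have e2 := h.pol_add_tri_eq h₁ h₂
  have key : ∀ s t : k, (s ≠ 0 ∨ t ≠ 0) →
      s * pol T x y' + t * tri T x y y' = 0 → False := by
    intro s t hst hm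
    have hx0 := h.left.cub_eq _ h₁.mem_left
    have hy0 := h.mid.cub_eq _ h₁.mem_right
    refine hN.point (s • x + t • y) (fun h0 => ?_) ?_ ?_
    · obtain ⟨rfl, rfl⟩ := hxy s t h0
      simp at hst
    · rw [cub_smul_add_smul, hx0, hy0, e1, h0]
      ring
    · have hz : ∀ v, pol T (s • x + t • y) v = polHom T (s • x + t • y) v := fun _ => rfl
      have hle : a ⊔ b ≤ LinearMap.ker (polHom T (s • x + t • y)) := by
        rw [← span_pair_eq h.left.finrank_eq h₁.mem_left h₂.mem_left hli,
          ← span_pair_eq h.mid.finrank_eq h₁.mem_right h₂.mem_right hli', sup_le_iff,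
          Submodule.span_le, Submodule.span_le]
        constructor
        · rintro z (rfl | rfl)
          · change pol T _ _ = 0
            rw [pol_smul_add_smul_left, tri_self_left, pol_self, hx0, e1, h0]
            ring
          · change pol T _ _ = 0
            rw [pol_smul_add_smul_left, h.left.pol_eq _ h₁.mem_left _ h₂.mem_left,
              tri_swap, tri_rotate]
            linear_combination (s * t) * h0' - t * hm + t ^ 2 * e2 - t ^ 2 * h0'
        · rintro z (rfl | rfl)
          · change pol T _ _ = 0
            rw [pol_smul_add_smul_left, tri_self_right, pol_self, hy0, e1, h0]
            ring
          · change pol T _ _ = 0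
            rw [pol_smul_add_smul_left, h.mid.pol_eq _ h₁.mem_right _ h₂.mem_right]
            linear_combination s * hm
      rw [sup_eq_top_of_inf_eq_bot hV h.left.finrank_eq h.mid.finrank_eq h.left_mid] at hle
      intro v
      rw [hz]
      exact hle (Submodule.mem_top (x := v))
  by_cases hm : pol T x y' = 0
  · exact key 1 0 (by simp) (by simp [hm])
  · exact key (tri T x y y') (-pol T x y') (by simp [hm]) (by ring)

lemma SkewTriple.exists_corr_of_inf_ne_bot (h : SkewTriple T a b c) {d : Submodule k V}
    (hd : IsL T d) (hda : a ⊓ d ≠ ⊥) (hdb : b ⊓ d ≠ ⊥) (hdc : c ⊓ d ≠ ⊥) :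
    ∃ x y, x ≠ 0 ∧ Corr a b c x y ∧ pol T x y = 0 ∧ Submodule.span k {x, y} = d := by
  obtain ⟨x, ⟨hxa, hxd⟩, hx⟩ := Submodule.exists_mem_ne_zero_of_ne_bot hda
  obtain ⟨y, ⟨hyb, hyd⟩, hy⟩ := Submodule.exists_mem_ne_zero_of_ne_bot hdb
  obtain ⟨z, ⟨hzc, hzd⟩, hz⟩ := Submodule.exists_mem_ne_zero_of_ne_bot hdc
  have hli : LinearIndependent k ![x, y] := by
    rw [LinearIndependent.pair_iff' hx]
    rintro r rfl
    exact hy (eq_zero_of_inf_eq_bot h.left_mid (a.smul_mem _ hxa) hyb)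
  rw [← span_pair_eq hd.finrank_eq hxd hyd hli] at hzd
  obtain ⟨s, t, rfl⟩ := Submodule.mem_span_pair.mp hzd
  have hs : s • x ≠ 0 := by
    intro hs
    rw [hs, zero_add] at hzc hz
    exact hz (eq_zero_of_inf_eq_bot h.mid_right (b.smul_mem _ hyb) hzc)
  have hcorr : Corr a b c (s • x) (t • y) := ⟨a.smul_mem _ hxa, b.smul_mem _ hyb, hzc⟩
  have hsx := d.smul_mem s hxd
  have hty := d.smul_mem t hyd
  exact ⟨s • x, t • y, hs, hcorr, hd.pol_eq _ hsx _ hty,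
    span_pair_eq hd.finrank_eq hsx hty (h.corr_linearIndependent hcorr hs)⟩

lemma SkewTriple.linearIndependent_of_span_ne (h : SkewTriple T a b c) (h₁ : Corr a b c x y)
    (h₂ : Corr a b c x' y') (hx : x ≠ 0) (hx' : x' ≠ 0)
    (hne : Submodule.span k {x, y} ≠ Submodule.span k {x', y'}) :
    LinearIndependent k ![x, x'] := by
  rw [LinearIndependent.pair_iff' hx]
  rintro r rfl
  obtain rfl := h.corr_unique (h₁.smul r) h₂
  refine hne (eq_of_le_of_finrank_two
    (finrank_span_pair (h.corr_linearIndependent h₂ hx'))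
    (finrank_span_pair (h.corr_linearIndependent h₁ hx)) ?_).symm
  rw [Submodule.span_le]
  rintro z (rfl | rfl)
  · exact Submodule.smul_mem _ _ (Submodule.subset_span (by simp))
  · exact Submodule.smul_mem _ _ (Submodule.subset_span (by simp))

lemma pol_lin_lin (T : V →ₗ[k] V →ₗ[k] V →ₗ[k] k) (u₀ u₁ u₂ u₃ : V) (s t : k) :
    pol T (s • u₀ + t • u₁) (s • u₂ + t • u₃) =
      s ^ 3 * pol T u₀ u₂ + s ^ 2 * t * (pol T u₀ u₃ + tri T u₀ u₁ u₂) +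
      s * t ^ 2 * (pol T u₁ u₂ + tri T u₁ u₀ u₃) + t ^ 3 * pol T u₁ u₃ := by
  simp only [tri, pol, map_add, map_smul, LinearMap.add_apply, LinearMap.smul_apply, smul_eq_mul]
  ring

/-- At most three lines meet each of three pairwise skew lines. -/
lemma SkewTriple.false_of_four (hN : Nonsing T) (hV : Module.finrank k V = 4)
    (h : SkewTriple T a b c) (d : Fin 4 → Submodule k V) (hd : Function.Injective d)
    (hL : ∀ i, IsL T (d i)) (ha : ∀ i, a ⊓ d i ≠ ⊥) (hb : ∀ i, b ⊓ d i ≠ ⊥)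
    (hc : ∀ i, c ⊓ d i ≠ ⊥) : False := by
  choose x y hx hxy hpol hspan using fun i =>
    h.exists_corr_of_inf_ne_bot (hL i) (ha i) (hb i) (hc i)
  have hli : ∀ i j, i ≠ j → LinearIndependent k ![x i, x j] := fun i j hij =>
    h.linearIndependent_of_span_ne (hxy i) (hxy j) (hx i) (hx j)
      (by rw [hspan, hspan]; exact hd.ne hij)
  set g₁ := pol T (x 0) (y 1) + tri T (x 0) (x 1) (y 0) with hg₁
  set g₂ := pol T (x 1) (y 0) + tri T (x 1) (x 0) (y 1) with hg₂
  have key : ∀ i, i ≠ 0 → i ≠ 1 → ∃ s t : k, x i = s • x 0 + t • x 1 ∧ s * g₁ + t * g₂ = 0 := by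
    intro i hi0 hi1
    have hmem := (hxy i).mem_left
    rw [← span_pair_eq h.left.finrank_eq (hxy 0).mem_left (hxy 1).mem_left
      (hli 0 1 (by decide))] at hmem
    obtain ⟨s, t, hst⟩ := Submodule.mem_span_pair.mp hmem
    refine ⟨s, t, hst.symm, ?_⟩
    have hs : s ≠ 0 := by
      rintro rfl
      rw [zero_smul, zero_add] at hst
      exact (LinearIndependent.pair_iff' (hx 1)).mp (hli 1 i hi1.symm) t hst
    have ht : t ≠ 0 := by
      rintro rfl
      rw [zero_smul, add_zero] at hst
      exact (LinearIndependent.pair_iff' (hx 0)).mp (hli 0 i hi0.symm) s hst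
    have hy := h.corr_unique (hst ▸ (hxy 0).lin (hxy 1) s t) (hxy i)
    have hp := hpol i
    rw [← hst, ← hy, pol_lin_lin, hpol 0, hpol 1, ← hg₁, ← hg₂] at hp
    have : s * t * (s * g₁ + t * g₂) = 0 := by linear_combination hp
    simpa [hs, ht] using this
  obtain ⟨s, t, hst, e⟩ := key 2 (by decide) (by decide)
  obtain ⟨s', t', hst', e'⟩ := key 3 (by decide) (by decide)
  have hdet : s * t' - s' * t ≠ 0 := by
    intro hdet
    have h23 := LinearIndependent.pair_iff.mp (hli 2 3 (by decide))
    have h1 := h23 t' (-t) (by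
      rw [hst, hst', show t' • (s • x 0 + t • x 1) + -t • (s' • x 0 + t' • x 1) =
        (s * t' - s' * t) • x 0 by module, hdet, zero_smul])
    have h2 := h23 s' (-s) (by
      rw [hst, hst', show s' • (s • x 0 + t • x 1) + -s • (s' • x 0 + t' • x 1) =
        -(s * t' - s' * t) • x 1 by module, hdet, neg_zero, zero_smul])
    refine hx 2 ?_
    rw [hst, neg_eq_zero.mp h1.2, neg_eq_zero.mp h2.2, zero_smul, zero_smul, add_zero]
  have h1 : (s * t' - s' * t) * g₁ = 0 := by linear_combination t' * e - t * e'
  exact h.no_double_root hN hV (hxy 0) (hxy 1) (hli 0 1 (by decide)) (hpol 0)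
    ((mul_eq_zero.mp h1).resolve_left hdet)

end SkewLines

section Transversal

variable {k V : Type*} [Field k] [AddCommGroup V] [Module k V]
  {T : V →ₗ[k] V →ₗ[k] V →ₗ[k] k} {a b c d : Submodule k V}

lemma cub_lin_lin (T : V →ₗ[k] V →ₗ[k] V →ₗ[k] k) (x y : V) (r : k) :
    cub T (x + r • y) = cub T x + r * pol T x y + r ^ 2 * pol T y x + r ^ 3 * cub T y := by
  rw [cub_add, cub_smul, pol_smul_left, pol_smul_right]

/-- The correspondences attached to `c` and `d` are not proportional. -/
lemma SkewTriple.exists_linearIndependent (hN : Nonsing T) (hV : Module.finrank k V = 4)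
    (h : SkewTriple T a b c) (h' : SkewTriple T a b d) (hcd : c ⊓ d = ⊥) :
    ∃ x y w, Corr a b c x y ∧ Corr a b d x w ∧ LinearIndependent k ![y, w] := by
  by_contra! hcon
  have hscal : ∀ {x y : V}, x ≠ 0 → Corr a b c x y →
      ∃ r : k, r ≠ 0 ∧ 1 - r ≠ 0 ∧ Corr a b d x (r • y) := by
    intro x y hx hxy
    obtain ⟨w, hw⟩ := h'.exists_corr hV hxy.mem_left
    have hli := hcon _ _ _ hxy hw
    rw [LinearIndependent.pair_iff' (h.corr_ne_zero hxy hx)] at hli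
    push Not at hli
    obtain ⟨r, rfl⟩ := hli
    refine ⟨r, ?_, ?_, hw⟩
    · rintro rfl
      exact h'.corr_ne_zero hw hx (zero_smul _ _)
    · intro hr
      rw [← sub_eq_zero.mp hr, one_smul] at hw
      have h0 := eq_zero_of_inf_eq_bot hcd hxy.add_mem hw.add_mem
      exact one_ne_zero
        (LinearIndependent.pair_iff.mp (h.corr_linearIndependent hxy hx) 1 1 (by simpa using h0)).1
  obtain ⟨x, hxa, hx⟩ := Submodule.exists_mem_ne_zero_of_ne_bot
    (show a ≠ ⊥ by
      rintro rfl
      simpa using h.left.finrank_eq)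
  obtain ⟨x', hxa', hli⟩ := exists_second h.left.finrank_eq hx
  have hx' : x' ≠ 0 := hli.ne_zero 1
  obtain ⟨y, hxy⟩ := h.exists_corr hV hxa
  obtain ⟨y', hxy'⟩ := h.exists_corr hV hxa'
  have hliy := h.swap.linearIndependent_left hxy.swap hxy'.swap hli
  obtain ⟨r, hr0, hr1, hr⟩ := hscal hx hxy
  obtain ⟨r', -, -, hr'⟩ := hscal hx' hxy'
  have hadd : x + x' ≠ 0 := fun h0 =>
    one_ne_zero (LinearIndependent.pair_iff.mp hli 1 1 (by simpa using h0)).1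
  have hsum := hxy.lin hxy' 1 1
  simp only [one_smul] at hsum
  obtain ⟨r'', -, -, hr''⟩ := hscal hadd hsum
  have hsum' := hr.lin hr' 1 1
  simp only [one_smul] at hsum'
  have hu := h'.corr_unique hsum' hr''
  have hrr : r - r'' = 0 ∧ r' - r'' = 0 := LinearIndependent.pair_iff.mp hliy _ _ (by
    rw [show (r - r'') • y + (r' - r'') • y' = r • y + r' • y' - r'' • (y + y') by module, hu,
      sub_self])
  obtain rfl : r = r' := by rw [sub_eq_zero.mp hrr.1, sub_eq_zero.mp hrr.2]
  refine h.no_double_root hN hV hxy hxy' hli ?_ ?_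
  · have e := h'.right.cub_eq _ hr.add_mem
    rw [cub_lin_lin, h.left.cub_eq _ hxa, h.mid.cub_eq _ hxy.mem_right, h.pol_eq_neg hxy] at e
    have : r * (1 - r) * pol T x y = 0 := by linear_combination e
    simpa [hr0, hr1] using this
  · have e := h'.pol_add_tri_eq hr hr'
    rw [pol_smul_left, tri_smul_right, tri_smul_mid, pol_smul_right, tri_smul_right] at e
    have : r * (1 - r) * (pol T x y' + tri T x x' y) = 0 := by
      linear_combination e - r ^ 2 * h.pol_add_tri_eq hxy hxy'
    simpa [hr0, hr1] using this

lemma pol_lin_lin_derivative (T : V →ₗ[k] V →ₗ[k] V →ₗ[k] k) (u₀ u₁ u₂ u₃ : V) (s t s' t' : k) :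
    pol T (s • u₀ + t • u₁) (s' • u₂ + t' • u₃) +
      tri T (s • u₀ + t • u₁) (s' • u₀ + t' • u₁) (s • u₂ + t • u₃) =
      3 * s ^ 2 * s' * pol T u₀ u₂ +
      (2 * s * s' * t + s ^ 2 * t') * (pol T u₀ u₃ + tri T u₀ u₁ u₂) +
      (2 * t * t' * s + t ^ 2 * s') * (pol T u₁ u₂ + tri T u₁ u₀ u₃) +
      3 * t ^ 2 * t' * pol T u₁ u₃ := by
  simp only [tri, pol, map_add, map_smul, LinearMap.add_apply, LinearMap.smul_apply, smul_eq_mul]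
  ring

lemma SkewTriple.cofactor (h : SkewTriple T a b c) (h' : SkewTriple T a b d)
    {u₀ u₁ u₂ u₃ : V} {δ t : k} (hδ : δ ≠ 0) (hδt : 1 - t + δ ≠ 0) (h02 : Corr a b c u₀ u₂)
    (h13 : Corr a b c u₁ u₃) (h03 : Corr a b d u₀ u₃)
    (hw : Corr a b d u₁ (-δ • u₂ + t • u₃)) :
    pol T u₁ u₃ = δ * (pol T u₀ u₃ + tri T u₀ u₁ u₂ - t * pol T u₀ u₂) ∧
      pol T u₁ u₂ + tri T u₁ u₀ u₃ =
        δ * pol T u₀ u₂ + t * (pol T u₀ u₃ + tri T u₀ u₁ u₂ - t * pol T u₀ u₂) := by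
  have z02 := h.pol_eq_neg h02
  have z13 := h.pol_eq_neg h13
  have z0213 := h.pol_add_tri_eq h02 h13
  have z1302 := h.pol_add_tri_eq h13 h02
  have z03 := h'.pol_eq_neg h03
  have zw := h'.pol_eq_neg hw
  have z03w := h'.pol_add_tri_eq h03 hw
  have zw03 := h'.pol_add_tri_eq hw h03
  simp only [pol_smul_add_smul_left, pol_add_right, pol_smul_right, tri_add_right, tri_smul_right,
    tri_add_mid, tri_smul_mid, tri_self_right] at zw z03w zw03
  have e230 : tri T u₂ u₃ u₀ = tri T u₀ u₂ u₃ := (tri_rotate T u₀ u₂ u₃).symm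
  have e231 : tri T u₂ u₃ u₁ = tri T u₁ u₂ u₃ := (tri_rotate T u₁ u₂ u₃).symm
  have e032 : tri T u₀ u₃ u₂ = tri T u₀ u₂ u₃ := by
    rw [tri_rotate, tri_swap, e230]
  have e132 : tri T u₁ u₃ u₂ = tri T u₁ u₂ u₃ := by
    rw [tri_rotate, tri_swap, e231]
  have e103 : tri T u₀ u₁ u₃ = tri T u₁ u₀ u₃ := tri_swap ..
  have e102 : tri T u₁ u₀ u₂ = tri T u₀ u₁ u₂ := tri_swap ..
  have m0 : tri T u₀ u₂ u₃ = -(pol T u₀ u₃ + tri T u₀ u₁ u₂) - pol T u₂ u₁ := by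
    linear_combination z0213
  have m1 : tri T u₁ u₂ u₃ = -(pol T u₁ u₂ + tri T u₁ u₀ u₃) - pol T u₃ u₀ := by
    linear_combination z1302 - e132
  rw [e231, m1, z13] at zw
  rw [e032, m0, e103, z13] at z03w
  rw [e102, e230, m0, m1, z02, z13] at zw03
  have E1 : pol T u₁ u₃ = δ * (pol T u₀ u₃ + tri T u₀ u₁ u₂ - t * pol T u₀ u₂) := by
    refine mul_left_cancel₀ hδt ?_
    linear_combination zw - δ * (z03w - t * z03) - (t - 1) * (zw03 - δ * z03 - t * (z03w - t * z03))
  refine ⟨E1, mul_left_cancel₀ hδ ?_⟩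
  linear_combination zw03 - δ * z03 - t * (z03w - t * z03) - (1 - t) * E1

/-- Given four pairwise skew lines, some line meets the first three but not the fourth. -/
lemma SkewTriple.exists_transversal (hN : Nonsing T) (hV : Module.finrank k V = 4)
    (h : SkewTriple T a b c) (h' : SkewTriple T a b d) (hcd : c ⊓ d = ⊥) :
    ∃ e, IsL T e ∧ a ⊓ e ≠ ⊥ ∧ b ⊓ e ≠ ⊥ ∧ c ⊓ e ≠ ⊥ ∧ d ⊓ e = ⊥ := by
  obtain ⟨u₀, u₂, u₃, h02, h03, hli⟩ := h.exists_linearIndependent hN hV h' hcd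
  have hli' := LinearIndependent.pair_iff.mp hli
  obtain ⟨u₁, h31⟩ := h.swap.exists_corr hV h03.mem_right
  have h13 := h31.swap
  have hu := h.linearIndependent_left h02 h13 hli
  have hu' := LinearIndependent.pair_iff.mp hu
  obtain ⟨w, hw⟩ := h'.exists_corr hV h13.mem_left
  obtain ⟨δ, t, rfl⟩ : ∃ δ t : k, w = -δ • u₂ + t • u₃ := by
    have hmem := hw.mem_right
    rw [← span_pair_eq h.mid.finrank_eq h02.mem_right h03.mem_right hli] at hmem
    obtain ⟨s, t, hst⟩ := Submodule.mem_span_pair.mp hmem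
    exact ⟨-s, t, by rw [neg_neg, hst]⟩
  have hδ : δ ≠ 0 := by
    rintro rfl
    have h1 := h03.lin hw (-t) 1
    rw [show -t • u₃ + (1 : k) • (-(0 : k) • u₂ + t • u₃) = 0 by module] at h1
    exact h'.corr_ne_zero h1 (fun h0 => one_ne_zero (hu' _ _ h0).2) rfl
  have hδt : 1 - t + δ ≠ 0 := by
    intro h0
    have h1 := h02.lin h13 (-δ) 1
    have h2 := h03.lin hw (-δ) 1
    rw [show -δ • u₃ + (1 : k) • (-δ • u₂ + t • u₃) = -δ • u₂ + (1 : k) • u₃ by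
      rw [show t = 1 + δ by linear_combination -h0]
      module] at h2
    have hne : -δ • u₂ + (1 : k) • u₃ ≠ 0 := fun h0 => one_ne_zero (hli' _ _ h0).2
    have hz := eq_zero_of_inf_eq_bot hcd h1.add_mem h2.add_mem
    rw [add_comm] at hz
    exact one_ne_zero (LinearIndependent.pair_iff.mp (h.swap.corr_linearIndependent h1.swap hne)
      1 1 (by simpa only [one_smul] using hz)).1
  obtain ⟨hg3, hg2⟩ := h.cofactor h' hδ hδt h02 h13 h03 hw
  have hroot := pol_lin_lin T u₀ u₁ u₂ u₃
  have hder := pol_lin_lin_derivative T u₀ u₁ u₂ u₃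
  set g₀ := pol T u₀ u₂
  set g₁ := pol T u₀ u₃ + tri T u₀ u₁ u₂
  set g₂ := pol T u₁ u₂ + tri T u₁ u₀ u₃
  set g₃ := pol T u₁ u₃
  obtain ⟨l, hl⟩ : ∃ l, g₁ = l + t * g₀ := ⟨g₁ - t * g₀, by ring⟩
  rw [hl] at hg2 hg3
  have hcorr := h02.lin h13 (-l) g₀
  have hcorr' := h03.lin hw (-l) g₀
  have hP : -l • u₀ + g₀ • u₁ ≠ 0 := by
    intro h0
    obtain ⟨h0, h0'⟩ := hu' _ _ h0
    refine h.no_double_root hN hV h02 h13 hu h0' ?_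
    change g₁ = 0
    rw [hl, h0', neg_eq_zero.mp h0, mul_zero, add_zero]
  have hχ : l ^ 2 - t * l * g₀ + δ * g₀ ^ 2 ≠ 0 := by
    intro hχ
    obtain ⟨r, hra, hr⟩ := exists_second h.left.finrank_eq hP
    rw [← span_pair_eq h.left.finrank_eq h02.mem_left h13.mem_left hu] at hra
    obtain ⟨r₀, r₁, rfl⟩ := Submodule.mem_span_pair.mp hra
    refine h.no_double_root hN hV hcorr (h02.lin h13 r₀ r₁) hr ?_ ?_
    · rw [hroot, hg2, hg3, hl]
      ring
    · rw [hder, hg2, hg3, hl]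
      linear_combination (g₀ * r₀ + l * r₁) * hχ
  have hli2 := h.corr_linearIndependent hcorr hP
  have hpol : pol T (-l • u₀ + g₀ • u₁) (-l • u₂ + g₀ • u₃) = 0 := by
    rw [hroot, hg2, hg3, hl]
    ring
  set P := -l • u₀ + g₀ • u₁ with hPdef
  set P' := -l • u₂ + g₀ • u₃ with hPdef'
  have hPmem : P ∈ Submodule.span k {P, P'} := Submodule.subset_span (by simp)
  have hPmem' : P' ∈ Submodule.span k {P, P'} := Submodule.subset_span (by simp)
  refine ⟨Submodule.span k {P, P'}, isL_span_pair hli2 (h.left.cub_eq _ hcorr.mem_left) hpol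
    (by rw [h.pol_eq_neg hcorr, hpol, neg_zero]) (h.mid.cub_eq _ hcorr.mem_right),
    (Submodule.ne_bot_iff _).mpr ⟨P, ⟨hcorr.mem_left, hPmem⟩, hP⟩,
    (Submodule.ne_bot_iff _).mpr ⟨P', ⟨hcorr.mem_right, hPmem'⟩, hli2.ne_zero 1⟩,
    (Submodule.ne_bot_iff _).mpr ⟨P + P', ⟨hcorr.add_mem, add_mem hPmem hPmem'⟩, fun h0 =>
      one_ne_zero (LinearIndependent.pair_iff.mp hli2 1 1 (by simpa using h0)).1⟩, ?_⟩
  rw [Submodule.eq_bot_iff]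
  rintro z ⟨hzd, hz⟩
  obtain ⟨s, s', rfl⟩ := Submodule.mem_span_pair.mp hz
  have hs : s = 0 := by
    have hz' : Corr a b d (s • P) (s' • P') :=
      ⟨a.smul_mem _ hcorr.mem_left, b.smul_mem _ hcorr.mem_right, hzd⟩
    have heq := h'.corr_unique hz' (hcorr'.smul s)
    obtain ⟨e, e'⟩ := hli' (-(s' * l) + s * δ * g₀) (s' * g₀ + s * l - s * g₀ * t) (by
      rw [show (-(s' * l) + s * δ * g₀) • u₂ + (s' * g₀ + s * l - s * g₀ * t) • u₃ =
        s' • P' - s • (-l • u₃ + g₀ • (-δ • u₂ + t • u₃)) by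
          rw [hPdef']
          module, heq, sub_self])
    have : s * (l ^ 2 - t * l * g₀ + δ * g₀ ^ 2) = 0 := by linear_combination g₀ * e + l * e'
    exact (mul_eq_zero.mp this).resolve_right hχ
  rw [hs, zero_smul, zero_add] at hzd ⊢
  exact eq_zero_of_inf_eq_bot h'.mid_right (b.smul_mem _ hcorr.mem_right) hzd

end Transversal

section Incidence

lemma finite_and_ncard_le {S : Type*} {s : Set S} {n : ℕ}
    (h : ∀ e : Fin (n + 1) → S, Function.Injective e → (∀ i, e i ∈ s) → False) :
    s.Finite ∧ s.ncard ≤ n := by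
  rw [← Set.encard_le_coe_iff_finite_ncard_le]
  by_contra hlt
  rw [not_le] at hlt
  obtain ⟨t, hts, ht⟩ := Set.exists_subset_encard_eq (Order.add_one_le_of_lt hlt)
  have htn : t.encard = (n + 1 : ℕ) := by exact_mod_cast ht
  have hfin : t.Finite := Set.finite_of_encard_eq_coe htn
  have hcard : Nat.card t = n + 1 := by
    rw [Nat.card_coe_set_eq, Set.ncard, htn, ENat.toNat_natCast]
  have : Finite t := hfin
  let e := (Finite.equivFinOfCardEq hcard).symm
  exact h (fun i => e i) (Subtype.val_injective.comp e.injective) fun i => hts (e i).2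

/-- The properties of the incidence graph of the lines on a smooth cubic surface that determine
the possible numbers of lines. -/
structure LineGraph {S : Type*} (G : SimpleGraph S) : Prop where
  third : ∀ {a b}, G.Adj a b → ∃ c, G.Adj a c ∧ G.Adj b c
  unique : ∀ {a b c d}, G.Adj a b → G.Adj a c → G.Adj b c → G.Adj a d → G.Adj b d → c = d
  cover : ∀ {a b c}, G.Adj a b → G.Adj a c → G.Adj b c →
    ∀ d, d = a ∨ d = b ∨ d = c ∨ G.Adj d a ∨ G.Adj d b ∨ G.Adj d c
  transversal : ∀ {a b c d}, Gᶜ.Adj a b → Gᶜ.Adj a c → Gᶜ.Adj b c → Gᶜ.Adj a d → Gᶜ.Adj b d →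
    Gᶜ.Adj c d → ∃ e, G.Adj a e ∧ G.Adj b e ∧ G.Adj c e ∧ ¬G.Adj d e
  false_of_four : ∀ {a b c}, Gᶜ.Adj a b → Gᶜ.Adj a c → Gᶜ.Adj b c → ∀ e : Fin 4 → S,
    Function.Injective e → (∀ i, G.Adj a (e i) ∧ G.Adj b (e i) ∧ G.Adj c (e i)) → False

namespace LineGraph

variable {S : Type*} {G : SimpleGraph S} {x y : S}

lemma compl_adj_of_two (hG : LineGraph G) {a b c d : S} (hcd : c ≠ d) (hab : a ≠ b)
    (hac : G.Adj a c) (had : G.Adj a d) (hbc : G.Adj b c) (hbd : G.Adj b d) : Gᶜ.Adj a b :=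
  (G.compl_adj a b).mpr ⟨hab, fun h => hcd (hG.unique h hac hbc had hbd)⟩

lemma exists_partner (hG : LineGraph G) (x : S) :
    ∃ f : S → S, ∀ z, G.Adj x z → G.Adj x (f z) ∧ G.Adj z (f z) := by
  have : ∀ z, ∃ t, G.Adj x z → G.Adj x t ∧ G.Adj z t := by
    intro z
    by_cases h : G.Adj x z
    · obtain ⟨t, ht⟩ := hG.third h
      exact ⟨t, fun _ => ht⟩
    · exact ⟨z, fun h' => absurd h' h⟩
  choose f hf using this
  exact ⟨f, hf⟩

/-- A set of pairwise skew neighbours of `x`, together with the third lines of the planes they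
span with `x`. -/
lemma exists_double (hG : LineGraph G) {E : Set S} (hE : E ⊆ G.neighborSet x)
    (hsk : E.Pairwise Gᶜ.Adj) (hfin : E.Finite) :
    ∃ D ⊆ G.neighborSet x, D.Finite ∧ D.ncard = 2 * E.ncard ∧
      ∀ t, G.Adj x t → (t ∈ E ∨ ∃ z ∈ E, G.Adj z t) → t ∈ D := by
  obtain ⟨f, hf⟩ := hG.exists_partner x
  have hinj : Set.InjOn f E := fun z hz z' hz' h =>
    hG.unique (hf z (hE hz)).1 (hE hz) (hf z (hE hz)).2.symm (hE hz')
      (h ▸ (hf z' (hE hz')).2.symm)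
  have hdisj : Disjoint E (f '' E) := by
    rw [Set.disjoint_left]
    rintro _ hz' ⟨z, hz, rfl⟩
    have hadj := (hf z (hE hz)).2
    exact ((G.compl_adj _ _).mp (hsk hz hz' hadj.ne)).2 hadj
  refine ⟨E ∪ f '' E, Set.union_subset hE ?_, hfin.union (hfin.image f), ?_, ?_⟩
  · rintro _ ⟨z, hz, rfl⟩
    exact (hf z (hE hz)).1
  · rw [Set.ncard_union_eq hdisj hfin (hfin.image f), hinj.ncard_image, two_mul]
  · rintro t hxt (ht | ⟨z, hz, hzt⟩)
    · exact Or.inl ht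
    · exact Or.inr ⟨z, hz, hG.unique (hE hz) (hf z (hE hz)).1 (hf z (hE hz)).2 hxt hzt⟩

lemma ncard_neighborSet (hG : LineGraph G) {E : Set S} (hE : E ⊆ G.neighborSet x)
    (hsk : E.Pairwise Gᶜ.Adj) (hfin : E.Finite)
    (hcov : ∀ t, G.Adj x t → t ∈ E ∨ ∃ z ∈ E, G.Adj z t) :
    (G.neighborSet x).Finite ∧ (G.neighborSet x).ncard = 2 * E.ncard := by
  obtain ⟨D, hD, hDfin, hcard, h⟩ := hG.exists_double hE hsk hfin
  rw [show G.neighborSet x = D from Set.Subset.antisymm (fun t ht => h t ht (hcov t ht)) hD]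
  exact ⟨hDfin, hcard⟩

lemma pairwise_commonNeighbors (hG : LineGraph G) (hxy : x ≠ y) :
    (G.commonNeighbors x y).Pairwise Gᶜ.Adj := by
  rintro c ⟨hxc, hyc⟩ d ⟨hxd, hyd⟩ hcd
  exact hG.compl_adj_of_two hxy hcd hxc.symm hyc.symm hxd.symm hyd.symm

/-- A transversal of three skew lines `c₀, c₁, c₂`, skew to two others. -/
lemma exists_transversal (hG : LineGraph G) (hxy : Gᶜ.Adj x y) {c₀ c₁ c₂ c₃ : S}
    (h₀ : c₀ ∈ G.commonNeighbors x y) (h₁ : c₁ ∈ G.commonNeighbors x y)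
    (h₂ : c₂ ∈ G.commonNeighbors x y) (h₃ : c₃ ∈ G.commonNeighbors x y)
    (h₀₁ : c₀ ≠ c₁) (h₀₂ : c₀ ≠ c₂) (h₁₂ : c₁ ≠ c₂) (h₀₃ : c₀ ≠ c₃) (h₁₃ : c₁ ≠ c₃)
    (h₂₃ : c₂ ≠ c₃) : ∃ b, G.Adj b c₀ ∧ G.Adj b c₁ ∧ G.Adj b c₂ ∧ ¬G.Adj b c₃ ∧
      Gᶜ.Adj x b ∧ Gᶜ.Adj y b := by
  have hsk := hG.pairwise_commonNeighbors hxy.ne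
  obtain ⟨b, e₀, e₁, e₂, e₃⟩ := hG.transversal (hsk h₀ h₁ h₀₁) (hsk h₀ h₂ h₀₂) (hsk h₁ h₂ h₁₂)
    (hsk h₀ h₃ h₀₃) (hsk h₁ h₃ h₁₃) (hsk h₂ h₃ h₂₃)
  refine ⟨b, e₀.symm, e₁.symm, e₂.symm, fun h => e₃ h.symm, ?_, ?_⟩
  · refine hG.compl_adj_of_two h₀₁ ?_ h₀.1 h₁.1 e₀.symm e₁.symm
    rintro rfl
    exact e₃ h₃.1.symm
  · refine hG.compl_adj_of_two h₀₁ ?_ h₀.2 h₁.2 e₀.symm e₁.symm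
    rintro rfl
    exact e₃ h₃.2.symm

lemma commonNeighbors_finite (hG : LineGraph G) (hxy : Gᶜ.Adj x y) :
    (G.commonNeighbors x y).Finite ∧ (G.commonNeighbors x y).ncard ≤ 5 := by
  refine finite_and_ncard_le fun e he hmem => ?_
  have hsk : ∀ i j, i ≠ j → Gᶜ.Adj (e i) (e j) := fun i j hij =>
    hG.pairwise_commonNeighbors hxy.ne (hmem i) (hmem j) (he.ne hij)
  obtain ⟨b, b₀, b₁, b₂, -, hxb, hyb⟩ := hG.exists_transversal hxy (hmem 0) (hmem 1) (hmem 2)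
    (hmem 3) (he.ne (by decide)) (he.ne (by decide)) (he.ne (by decide)) (he.ne (by decide))
    (he.ne (by decide)) (he.ne (by decide))
  have hb : ∀ j, 3 ≤ j → ¬G.Adj b (e j) := by
    intro j hj hbj
    refine hG.false_of_four hxy hxb hyb (e ∘ ![0, 1, 2, j]) (he.comp ?_) fun i => ?_
    · clear hbj
      revert j
      decide
    · fin_cases i
      · exact ⟨(hmem 0).1, (hmem 0).2, b₀⟩
      · exact ⟨(hmem 1).1, (hmem 1).2, b₁⟩
      · exact ⟨(hmem 2).1, (hmem 2).2, b₂⟩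
      · exact ⟨(hmem j).1, (hmem j).2, hbj⟩
  obtain ⟨w, hbw, h0w⟩ := hG.third b₀
  have hw : ∀ j, 3 ≤ j → G.Adj w (e j) := by
    intro j hj
    have hj0 := hsk j 0 (by
      rintro rfl
      exact absurd hj (by decide))
    rw [G.compl_adj] at hj0
    rcases hG.cover b₀ hbw h0w (e j) with h | h | h | h | h | h
    · exact absurd (h ▸ (hmem j).1) ((G.compl_adj _ _).mp hxb).2
    · exact absurd h hj0.1
    · exact absurd (h ▸ h0w).symm hj0.2
    · exact absurd h.symm (hb j hj)
    · exact absurd h hj0.2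
    · exact h.symm
  have h34 : e 3 ≠ e 4 := he.ne (by decide)
  have hskew : ∀ z, Gᶜ.Adj z b → G.Adj z (e 3) → G.Adj z (e 4) → Gᶜ.Adj z w := by
    intro z hzb h3 h4
    refine hG.compl_adj_of_two h34 ?_ h3 h4 (hw 3 le_rfl) (hw 4 (by decide))
    rintro rfl
    exact ((G.compl_adj _ _).mp hzb).2 hbw.symm
  refine hG.false_of_four hxy (hskew x hxb (hmem 3).1 (hmem 4).1)
    (hskew y hyb (hmem 3).2 (hmem 4).2) (e ∘ ![0, 3, 4, 5]) (he.comp (by decide)) fun i => ?_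
  fin_cases i
  · exact ⟨(hmem 0).1, (hmem 0).2, h0w.symm⟩
  · exact ⟨(hmem 3).1, (hmem 3).2, hw 3 (by decide)⟩
  · exact ⟨(hmem 4).1, (hmem 4).2, hw 4 (by decide)⟩
  · exact ⟨(hmem 5).1, (hmem 5).2, hw 5 (by decide)⟩

lemma ncard_neighborSet_of_skew (hG : LineGraph G) (hxy : Gᶜ.Adj x y) : (G.neighborSet x).Finite ∧
    (G.neighborSet x).ncard = 2 * (G.commonNeighbors x y).ncard := by
  refine hG.ncard_neighborSet Set.inter_subset_left (hG.pairwise_commonNeighbors hxy.ne)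
    (hG.commonNeighbors_finite hxy).1 fun t ht => ?_
  rw [G.compl_adj] at hxy
  obtain ⟨z, hxz, htz⟩ := hG.third ht
  rcases hG.cover ht hxz htz y with h | h | h | h | h | h
  · exact absurd h.symm hxy.1
  · exact absurd (h ▸ ht) hxy.2
  · exact absurd (h ▸ hxz) hxy.2
  · exact absurd h.symm hxy.2
  · exact Or.inl ⟨ht, h⟩
  · exact Or.inr ⟨z, ⟨hxz, h⟩, htz.symm⟩

lemma ncard_neighborSet_eq_of_skew (hG : LineGraph G) (hxy : Gᶜ.Adj x y) :
    (G.neighborSet x).ncard = (G.neighborSet y).ncard := by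
  rw [(hG.ncard_neighborSet_of_skew hxy).2, (hG.ncard_neighborSet_of_skew hxy.symm).2,
    G.commonNeighbors_symm]

lemma commonNeighbors_ncard_ne_four (hG : LineGraph G) (hx : ∀ x, ∃ y, Gᶜ.Adj x y)
    (hdeg : ∀ x y, (G.neighborSet x).ncard = (G.neighborSet y).ncard) (hxy : Gᶜ.Adj x y) :
    (G.commonNeighbors x y).ncard ≠ 4 := by
  intro h4
  have hfin := (hG.commonNeighbors_finite hxy).1
  have : Finite (G.commonNeighbors x y) := hfin
  let e := (Finite.equivFinOfCardEq ((Nat.card_coe_set_eq _).trans h4)).symm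
  have he : ∀ i j, i ≠ j → (e i : S) ≠ e j := fun i j hij h =>
    hij (e.injective (Subtype.val_injective h))
  obtain ⟨b, b₀, b₁, b₂, b₃, hxb, hyb⟩ := hG.exists_transversal hxy (e 0).2 (e 1).2 (e 2).2
    (e 3).2 (he _ _ (by decide)) (he _ _ (by decide)) (he _ _ (by decide)) (he _ _ (by decide))
    (he _ _ (by decide)) (he _ _ (by decide))
  obtain ⟨b', b'₀, b'₁, b'₃, b'₂, hxb', hyb'⟩ := hG.exists_transversal hxy (e 0).2 (e 1).2 (e 3).2
    (e 2).2 (he _ _ (by decide)) (he _ _ (by decide)) (he _ _ (by decide)) (he _ _ (by decide))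
    (he _ _ (by decide)) (he _ _ (by decide))
  obtain ⟨d, d₀, d₂, d₃, d₁, hxd, hyd⟩ := hG.exists_transversal hxy (e 0).2 (e 2).2 (e 3).2
    (e 1).2 (he _ _ (by decide)) (he _ _ (by decide)) (he _ _ (by decide)) (he _ _ (by decide))
    (he _ _ (by decide)) (he _ _ (by decide))
  have hbb' : Gᶜ.Adj b b' := hG.compl_adj_of_two (he 0 1 (by decide))
    (fun h => b'₂ (h ▸ b₂)) b₀ b₁ b'₀ b'₁
  have hbd : Gᶜ.Adj b d := hG.compl_adj_of_two (he 0 2 (by decide))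
    (fun h => d₁ (h ▸ b₁)) b₀ b₂ d₀ d₂
  have hb'd : Gᶜ.Adj b' d := hG.compl_adj_of_two (he 0 3 (by decide))
    (fun h => d₁ (h ▸ b'₁)) b'₀ b'₃ d₀ d₃
  obtain ⟨z, hz⟩ := hx (e 0)
  have hcard : ({x, y, b, b', d} : Set S).ncard = 5 := by
    rw [Set.ncard_insert_of_notMem, Set.ncard_insert_of_notMem, Set.ncard_insert_of_notMem,
      Set.ncard_pair hb'd.ne]
    · simp [hbb'.ne, hbd.ne]
    · simp [hyb.ne, hyb'.ne, hyd.ne]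
    · simp [hxy.ne, hxb.ne, hxb'.ne, hxd.ne]
  obtain ⟨D, hD, -, hDcard, -⟩ := hG.exists_double (x := (e 0 : S)) (E := {x, y, b, b', d}) (by
    rintro t (rfl | rfl | rfl | rfl | rfl)
    · exact (e 0).2.1.symm
    · exact (e 0).2.2.symm
    · exact b₀.symm
    · exact b'₀.symm
    · exact d₀.symm) (by
    have : Std.Symm Gᶜ.Adj := ⟨fun _ _ h => h.symm⟩
    simp only [Set.pairwise_insert_of_symm, Set.pairwise_singleton]
    simp only [Set.mem_insert_iff, Set.mem_singleton_iff, forall_eq_or_imp, forall_eq]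
    tauto) (Set.toFinite _)
  have hle := Set.ncard_le_ncard hD (hG.ncard_neighborSet_of_skew hz).1
  rw [hDcard, hcard, hdeg _ x, (hG.ncard_neighborSet_of_skew hxy).2, h4] at hle
  omega

lemma ncard_univ_of_pencil (hG : LineGraph G) (hx : ∀ y, y ≠ x → G.Adj x y) :
    (Set.univ : Set S).Finite ∧ ∃ m ≤ 3, (Set.univ : Set S).ncard = 2 * m + 1 := by
  obtain ⟨E, hE⟩ := zorn_subset {E | E ⊆ G.neighborSet x ∧ E.Pairwise Gᶜ.Adj} (by
    intro C hC hchain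
    exact ⟨⋃₀ C, ⟨Set.sUnion_subset fun s hs => (hC hs).1,
      (Set.pairwise_sUnion hchain.directedOn).mpr fun s hs => (hC hs).2⟩,
      fun s hs => Set.subset_sUnion_of_mem hs⟩)
  obtain ⟨hEx, hEsk⟩ := hE.prop
  obtain ⟨hfin, hle⟩ : E.Finite ∧ E.ncard ≤ 3 := by
    refine finite_and_ncard_le fun e he hmem => ?_
    have hsk : ∀ i j, i ≠ j → Gᶜ.Adj (e i) (e j) := fun i j hij =>
      hEsk (hmem i) (hmem j) (he.ne hij)
    obtain ⟨b, h0, h1, -, h3⟩ := hG.transversal (hsk 0 1 (by decide)) (hsk 0 2 (by decide))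
      (hsk 1 2 (by decide)) (hsk 0 3 (by decide)) (hsk 1 3 (by decide)) (hsk 2 3 (by decide))
    have hbx : b ≠ x := by
      rintro rfl
      exact h3 (hEx (hmem 3)).symm
    exact he.ne (show (0 : Fin 4) ≠ 1 by decide)
      (hG.unique (hx b hbx) (hEx (hmem 0)) h0.symm (hEx (hmem 1)) h1.symm)
  obtain ⟨hN, hcard⟩ := hG.ncard_neighborSet hEx hEsk hfin fun t ht => by
    by_contra! hcon
    refine hcon.1 (hE.le_of_ge (y := insert t E) ⟨Set.insert_subset ht hEx, ?_⟩
      (Set.subset_insert t E) (Set.mem_insert t E))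
    have : Std.Symm Gᶜ.Adj := ⟨fun _ _ h => h.symm⟩
    refine Set.pairwise_insert_of_symm.mpr ⟨hEsk, fun z hz htz => ?_⟩
    exact (G.compl_adj _ _).mpr ⟨htz, fun h => hcon.2 z hz h.symm⟩
  have huniv : (Set.univ : Set S) = insert x (G.neighborSet x) := by
    refine (Set.eq_univ_of_forall fun y => ?_).symm
    by_cases h : y = x
    · exact Or.inl h
    · exact Or.inr (hx y h)
  rw [huniv]
  refine ⟨hN.insert x, E.ncard, hle, ?_⟩
  rw [Set.ncard_insert_of_notMem (by simp) hN, hcard]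

lemma ncard_univ_of_triangle (hG : LineGraph G) (hfin : ∀ x, (G.neighborSet x).Finite) {a b c : S}
    (hab : G.Adj a b) (hac : G.Adj a c) (hbc : G.Adj b c) : (Set.univ : Set S).Finite ∧
      (Set.univ : Set S).ncard + 3 =
        (G.neighborSet a).ncard + (G.neighborSet b).ncard + (G.neighborSet c).ncard := by
  have huniv : (Set.univ : Set S) = G.neighborSet a ∪ G.neighborSet b ∪ G.neighborSet c := by
    refine (Set.eq_univ_of_forall fun d => ?_).symm
    rcases hG.cover hab hac hbc d with rfl | rfl | rfl | h | h | h
    · exact Or.inr hac.symm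
    · exact Or.inr hbc.symm
    · exact Or.inl (Or.inl hac)
    · exact Or.inl (Or.inl h.symm)
    · exact Or.inl (Or.inr h.symm)
    · exact Or.inr h.symm
  have h1 : G.neighborSet a ∩ G.neighborSet b = {c} := by
    ext d
    refine ⟨fun ⟨h, h'⟩ => hG.unique hab h h' hac hbc, ?_⟩
    rintro rfl
    exact ⟨hac, hbc⟩
  have h2 : (G.neighborSet a ∪ G.neighborSet b) ∩ G.neighborSet c = {a, b} := by
    ext d
    constructor
    · rintro ⟨h | h, h'⟩
      · exact Or.inr (hG.unique hac h h' hab hbc.symm)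
      · exact Or.inl (hG.unique hbc h h' hab.symm hac.symm)
    · rintro (rfl | rfl)
      · exact ⟨Or.inr hab.symm, hac.symm⟩
      · exact ⟨Or.inl hab, hbc.symm⟩
  have e1 := Set.ncard_union_add_ncard_inter _ _ (hfin a) (hfin b)
  have e2 := Set.ncard_union_add_ncard_inter _ _ ((hfin a).union (hfin b)) (hfin c)
  rw [h1, Set.ncard_singleton] at e1
  rw [h2, Set.ncard_pair hab.ne] at e2
  rw [huniv]
  exact ⟨((hfin a).union (hfin b)).union (hfin c), by omega⟩

lemma ncard_neighborSet_eq (hG : LineGraph G) (hsk : ∀ x, ∃ y, Gᶜ.Adj x y) (x y : S) :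
    (G.neighborSet x).ncard = (G.neighborSet y).ncard := by
  by_contra hne
  have hfin : ∀ x, (G.neighborSet x).Finite := fun x =>
    (hG.ncard_neighborSet_of_skew (hsk x).choose_spec).1
  have hxy : G.Adj x y := by
    by_contra h
    exact hne (hG.ncard_neighborSet_eq_of_skew ((G.compl_adj x y).mpr
      ⟨fun h => hne (by rw [h]), h⟩))
  obtain ⟨w, hxw, hyw⟩ := hG.third hxy
  have hw : ∀ z, G.Adj w z → z = x ∨ z = y := by
    intro z hz
    by_contra! hcon
    refine hne ((hG.ncard_neighborSet_eq_of_skew (y := z) ?_).trans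
      (hG.ncard_neighborSet_eq_of_skew (y := z) ?_).symm)
    · exact (G.compl_adj _ _).mpr ⟨hcon.1.symm, fun h => hcon.2 (hG.unique hxw h hz hxy hyw.symm)⟩
    · exact (G.compl_adj _ _).mpr
        ⟨hcon.2.symm, fun h => hcon.1 (hG.unique hyw h hz hxy.symm hxw.symm)⟩
  have hNw : (G.neighborSet w).ncard = 2 := by
    rw [show G.neighborSet w = {x, y} from Set.Subset.antisymm hw (by
      rintro z (rfl | rfl)
      · exact hxw.symm
      · exact hyw.symm), Set.ncard_pair hxy.ne]
  obtain ⟨z, hz⟩ := hsk w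
  have hNz := hNw ▸ (hG.ncard_neighborSet_eq_of_skew hz).symm
  have key : ∀ {p q}, G.Adj p q → G.Adj p w → G.Adj q w → (∀ t, G.Adj w t → t = p ∨ t = q) →
      G.Adj z p → False := by
    intro p q hpq hpw hqw hw hzp
    have hzq : Gᶜ.Adj z q := by
      refine (G.compl_adj _ _).mpr ⟨?_, fun h => ?_⟩
      · rintro rfl
        exact ((G.compl_adj _ _).mp hz).2 hqw.symm
      · exact hz.ne (hG.unique hpq hpw hqw hzp.symm h.symm)
    have hNq : {p, w} = G.neighborSet q := by
      refine Set.eq_of_subset_of_ncard_le ?_ ?_ (hfin q)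
      · rintro t (rfl | rfl)
        · exact hpq.symm
        · exact hqw
      · rw [← hG.ncard_neighborSet_eq_of_skew hzq, hNz, Set.ncard_pair hpw.ne]
    obtain ⟨t, ht⟩ := hsk p
    rw [G.compl_adj] at ht
    rcases hG.cover hpq hpw hqw t with h | h | h | h | h | h
    · exact ht.1 h.symm
    · exact ht.2 (h ▸ hpq)
    · exact ht.2 (h ▸ hpw)
    · exact ht.2 h.symm
    · have : t ∈ ({p, w} : Set S) := hNq ▸ h.symm
      rcases this with rfl | rfl
      · exact ht.1 rfl
      · exact ht.2 hpw
    · rcases hw t h.symm with rfl | rfl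
      · exact ht.1 rfl
      · exact ht.2 hpq
  have hz' := (G.compl_adj _ _).mp hz
  rcases hG.cover hxy hxw hyw z with h | h | h | h | h | h
  · exact hz'.2 (h ▸ hxw.symm)
  · exact hz'.2 (h ▸ hyw.symm)
  · exact hz'.1 h.symm
  · exact key hxy hxw hyw hw h
  · exact key hxy.symm hyw hxw (fun t ht => (hw t ht).symm) h
  · exact hz'.2 h.symm

theorem ncard_univ (hG : LineGraph G) : (Set.univ : Set S).Finite ∧
    (Set.univ : Set S).ncard ∈ ({0, 1, 2, 3, 5, 7, 9, 15, 27} : Set ℕ) := by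
  by_cases hedge : ∃ a b, G.Adj a b
  · by_cases hsk : ∀ x, ∃ y, Gᶜ.Adj x y
    · have hfin : ∀ x, (G.neighborSet x).Finite := fun x =>
        (hG.ncard_neighborSet_of_skew (hsk x).choose_spec).1
      have hdeg := hG.ncard_neighborSet_eq hsk
      obtain ⟨a, b, hab⟩ := hedge
      obtain ⟨c, hac, hbc⟩ := hG.third hab
      obtain ⟨d, had⟩ := hsk a
      obtain ⟨huniv, hcard⟩ := hG.ncard_univ_of_triangle hfin hab hac hbc
      rw [hdeg b a, hdeg c a, (hG.ncard_neighborSet_of_skew had).2] at hcard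
      have h4 := hG.commonNeighbors_ncard_ne_four hsk hdeg had
      have h5 := (hG.commonNeighbors_finite had).2
      refine ⟨huniv, ?_⟩
      simp only [Set.mem_insert_iff, Set.mem_singleton_iff]
      omega
    · push Not at hsk
      obtain ⟨x, hx⟩ := hsk
      obtain ⟨huniv, m, hm, hcard⟩ := hG.ncard_univ_of_pencil (x := x) fun y hyx => by
        by_contra h
        exact hx y ((G.compl_adj _ _).mpr ⟨hyx.symm, h⟩)
      refine ⟨huniv, ?_⟩
      simp only [Set.mem_insert_iff, Set.mem_singleton_iff]
      omega
  · push Not at hedge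
    obtain ⟨huniv, hle⟩ : (Set.univ : Set S).Finite ∧ (Set.univ : Set S).ncard ≤ 3 := by
      refine finite_and_ncard_le fun e he _ => ?_
      have hsk : ∀ i j, i ≠ j → Gᶜ.Adj (e i) (e j) := fun i j hij =>
        (G.compl_adj _ _).mpr ⟨he.ne hij, hedge _ _⟩
      obtain ⟨b, h0, -⟩ := hG.transversal (hsk 0 1 (by decide)) (hsk 0 2 (by decide))
        (hsk 1 2 (by decide)) (hsk 0 3 (by decide)) (hsk 1 3 (by decide)) (hsk 2 3 (by decide))
      exact hedge _ _ h0
    refine ⟨huniv, ?_⟩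
    simp only [Set.mem_insert_iff, Set.mem_singleton_iff]
    omega

end LineGraph

end Incidence

section Surface

variable {k V : Type*} [Field k] [AddCommGroup V] [Module k V]
  {T : V →ₗ[k] V →ₗ[k] V →ₗ[k] k}

/-- The incidence graph of the lines on the cubic attached to `T`. -/
def incidence (T : V →ₗ[k] V →ₗ[k] V →ₗ[k] k) : SimpleGraph {W : Submodule k V // IsL T W} where
  Adj a b := a ≠ b ∧ a.1 ⊓ b.1 ≠ ⊥
  symm := ⟨fun a b h => ⟨h.1.symm, by rw [inf_comm]; exact h.2⟩⟩
  loopless := ⟨fun _ h => h.1 rfl⟩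

lemma IsL.ne_bot {W : Submodule k V} (h : IsL T W) : W ≠ ⊥ := by
  rintro rfl
  simpa using h.finrank_eq

lemma incidence_compl_adj {a b : {W : Submodule k V // IsL T W}} :
    (incidence T)ᶜ.Adj a b ↔ a.1 ⊓ b.1 = ⊥ := by
  rw [SimpleGraph.compl_adj]
  refine ⟨fun h => of_not_not fun h' => h.2 ⟨h.1, h'⟩, fun h => ⟨?_, fun h' => h'.2 h⟩⟩
  rintro rfl
  exact a.2.ne_bot (by rwa [inf_idem] at h)

lemma incidence_adj_of_skew {a b c : {W : Submodule k V // IsL T W}} (h : a.1 ⊓ b.1 = ⊥)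
    (ha : a.1 ⊓ c.1 ≠ ⊥) (hb : b.1 ⊓ c.1 ≠ ⊥) : (incidence T).Adj a c := by
  refine ⟨?_, ha⟩
  rintro rfl
  exact hb (by rwa [inf_comm])

lemma Nonsing.lineGraph (hN : Nonsing T) (hV : Module.finrank k V = 4) :
    LineGraph (incidence T) := by
  have : FiniteDimensional k V := Module.finite_of_finrank_eq_succ hV
  have triple : ∀ {a b c : {W : Submodule k V // IsL T W}}, (incidence T)ᶜ.Adj a b →
      (incidence T)ᶜ.Adj a c → (incidence T)ᶜ.Adj b c → SkewTriple T a.1 b.1 c.1 :=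
    fun {a b c} hab hac hbc => ⟨a.2, b.2, c.2, incidence_compl_adj.mp hab,
      incidence_compl_adj.mp hac, incidence_compl_adj.mp hbc⟩
  have planar : ∀ {a b c : {W : Submodule k V // IsL T W}}, (incidence T).Adj a b →
      (incidence T).Adj a c → (incidence T).Adj b c → c.1 ≤ a.1 ⊔ b.1 := by
    intro a b c hab hac hbc
    exact a.2.le_sup hN hV b.2 c.2 (fun h => hab.1 (Subtype.ext h)) hab.2 hac.symm.2 hbc.symm.2
  have unique : ∀ {a b c d : {W : Submodule k V // IsL T W}}, (incidence T).Adj a b →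
      (incidence T).Adj a c → (incidence T).Adj b c → (incidence T).Adj a d →
      (incidence T).Adj b d → c = d := by
    intro a b c d hab hac hbc had hbd
    obtain ⟨e, -, -, -, -, -, -, he, -⟩ :=
      a.2.exists_third hN hV b.2 (fun h => hab.1 (Subtype.ext h)) hab.2
    have key : ∀ x : {W : Submodule k V // IsL T W}, (incidence T).Adj a x →
        (incidence T).Adj b x → x.1 = e := by
      intro x hax hbx
      rcases he x.1 x.2 (planar hab hax hbx) with h | h | h
      · exact absurd (Subtype.ext h.symm) hax.1
      · exact absurd (Subtype.ext h.symm) hbx.1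
      · exact h
    exact Subtype.ext ((key c hac hbc).trans (key d had hbd).symm)
  have third : ∀ {a b : {W : Submodule k V // IsL T W}}, (incidence T).Adj a b →
      ∃ c, (incidence T).Adj a c ∧ (incidence T).Adj b c ∧
        ∀ v ∈ a.1 ⊔ b.1, cub T v = 0 → v ∈ a.1 ∨ v ∈ b.1 ∨ v ∈ c.1 := by
    intro a b hab
    obtain ⟨e, heL, hea, heb, hae, hbe, -, -, hv⟩ :=
      a.2.exists_third hN hV b.2 (fun h => hab.1 (Subtype.ext h)) hab.2
    exact ⟨⟨e, heL⟩, ⟨fun h => hea (congrArg Subtype.val h).symm, hae⟩,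
      ⟨fun h => heb (congrArg Subtype.val h).symm, hbe⟩, hv⟩
  refine ⟨fun hab => ?_, unique, ?_, ?_, ?_⟩
  · obtain ⟨c, hac, hbc, -⟩ := third hab
    exact ⟨c, hac, hbc⟩
  · intro a b c hab hac hbc d
    obtain ⟨c', hac', hbc', hv⟩ := third hab
    obtain rfl := unique hab hac hbc hac' hbc'
    by_contra! hcon
    obtain ⟨hda, hdb, hdc, hda', hdb', hdc'⟩ := hcon
    have h3 := finrank_sup_eq_three a.2.finrank_eq b.2.finrank_eq
      (fun h => hab.1 (Subtype.ext h)) hab.2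
    have hlt : Module.finrank k ↥(a.1 ⊔ b.1 ⊔ d.1) ≤ 4 := hV ▸ Submodule.finrank_le _
    obtain ⟨x, ⟨hx, hxd⟩, hx0⟩ := Submodule.exists_mem_ne_zero_of_ne_bot
      (inf_ne_bot_of_finrank hlt (by rw [h3, d.2.finrank_eq]; norm_num))
    have hmeet : ∀ y : {W : Submodule k V // IsL T W}, x ∈ y.1 → d.1 ⊓ y.1 ≠ ⊥ := fun y hy =>
      (Submodule.ne_bot_iff _).mpr ⟨x, ⟨hxd, hy⟩, hx0⟩
    rcases hv x hx (d.2.cub_eq x hxd) with h | h | h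
    · exact hda' ⟨hda, hmeet a h⟩
    · exact hdb' ⟨hdb, hmeet b h⟩
    · exact hdc' ⟨hdc, hmeet c h⟩
  · intro a b c d hab hac hbc had hbd hcd
    obtain ⟨e, heL, ha, hb, hc, hd⟩ := (triple hab hac hbc).exists_transversal hN hV
      (triple hab had hbd) (incidence_compl_adj.mp hcd)
    rw [incidence_compl_adj] at hab hac hbc
    exact ⟨⟨e, heL⟩, incidence_adj_of_skew hab ha hb,
      incidence_adj_of_skew (inf_comm a.1 b.1 ▸ hab) hb ha,
      incidence_adj_of_skew (inf_comm a.1 c.1 ▸ hac) hc ha, fun h => h.2 hd⟩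
  · intro a b c hab hac hbc e he hadj
    exact (triple hab hac hbc).false_of_four hN hV (fun i => (e i).1)
      (Subtype.val_injective.comp he) (fun i => (e i).2) (fun i => (hadj i).1.2)
      (fun i => (hadj i).2.1.2) fun i => (hadj i).2.2.2

end Surface

end CubicLines

/-- over any field, the set of `k`-lines on a smooth cubic surface is
finite of cardinality 0, 1, 2, 3, 5, 7, 9, 15, or 27. -/
theorem line_count_smooth_cubic {k : Type*} [Field k] (f : MvPolynomial (Fin 4) k)
    (hf : IsSmoothCubic k f) :
    {W : Submodule k (Fin 4 → k) | IsLineOn f W}.Finite ∧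
      {W : Submodule k (Fin 4 → k) | IsLineOn f W}.ncard ∈
        ({0, 1, 2, 3, 5, 7, 9, 15, 27} : Set ℕ) := by
  obtain ⟨c, rfl⟩ := CubicLines.exists_cubicPoly_eq hf.2.1
  simp only [CubicLines.isLineOn_cubicPoly_iff]
  obtain ⟨hfin, hcard⟩ :=
    ((CubicLines.nonsing_of_isSmoothCubic hf).lineGraph (by simp)).ncard_univ
  rw [Set.ncard_univ] at hcard
  exact ⟨Set.finite_coe_iff.mp (Set.finite_univ_iff.mp hfin), hcard⟩
end

section
/- For each n ∈ {0, 1, 2, 3, 5, 7, 9, 15, 27} there exists a nonzero homogeneous polynomial f of degree 3 in four variables over ℚ defining a smooth cubic surface such that the set of lines on V(f) defined over ℚ has exactly n elements. -/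
open MvPolynomial

/-- The trilinear form `∑ c * uᵢ * vⱼ * wₖ` with one summand for each entry `(c, i, j, k)`
of `L`. -/
def trilinear {R : Type*} [CommRing R] (L : List (ℤ × Fin 4 × Fin 4 × Fin 4))
    (u v w : Fin 4 → R) : R :=
  (L.map fun m => (m.1 : R) * u m.2.1 * v m.2.2.1 * w m.2.2.2).sum

/-- The cubic form `∑ c * xᵢ * xⱼ * xₖ` with one summand for each entry `(c, i, j, k)` of `L`. -/
noncomputable def cubicForm (L : List (ℤ × Fin 4 × Fin 4 × Fin 4)) : MvPolynomial (Fin 4) ℚ :=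
  trilinear L X X X

/-- The coefficient of `s² t` in the restriction of the cubic form to `s • v + t • w`. -/
def mixedCoeff {R : Type*} [CommRing R] (L : List (ℤ × Fin 4 × Fin 4 × Fin 4))
    (v w : Fin 4 → R) : R :=
  trilinear L v v w + trilinear L v w v + trilinear L w v v

/-- The cubic form given by `L` vanishes identically on the span of `v` and `w`. -/
def VanishesOn {R : Type*} [CommRing R] (L : List (ℤ × Fin 4 × Fin 4 × Fin 4))
    (v w : Fin 4 → R) : Prop :=
  trilinear L v v v = 0 ∧ mixedCoeff L v w = 0 ∧ mixedCoeff L w v = 0 ∧ trilinear L w w w = 0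

section trilinear

variable {R : Type*} [CommRing R] (L : List (ℤ × Fin 4 × Fin 4 × Fin 4))

instance [DecidableEq R] (v w : Fin 4 → R) : Decidable (VanishesOn L v w) := by
  unfold VanishesOn; infer_instance

theorem map_trilinear {A : Type*} [CommRing A] (φ : R →+* A) (u v w : Fin 4 → R) :
    φ (trilinear L u v w) = trilinear L (φ ∘ u) (φ ∘ v) (φ ∘ w) := by
  induction L <;> simp_all [trilinear]

theorem trilinear_add_left (u u' v w : Fin 4 → R) :
    trilinear L (u + u') v w = trilinear L u v w + trilinear L u' v w := by
  simp only [trilinear, ← List.sum_map_add, Pi.add_apply]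
  congr! 2; ext; ring

theorem trilinear_smul_left (a : R) (u v w : Fin 4 → R) :
    trilinear L (a • u) v w = a * trilinear L u v w := by
  simp only [trilinear, ← List.sum_map_mul_left, Pi.smul_apply, smul_eq_mul]
  congr! 2; ext; ring

theorem trilinear_add_mid (u v v' w : Fin 4 → R) :
    trilinear L u (v + v') w = trilinear L u v w + trilinear L u v' w := by
  simp only [trilinear, ← List.sum_map_add, Pi.add_apply]
  congr! 2; ext; ring

theorem trilinear_smul_mid (a : R) (u v w : Fin 4 → R) :
    trilinear L u (a • v) w = a * trilinear L u v w := by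
  simp only [trilinear, ← List.sum_map_mul_left, Pi.smul_apply, smul_eq_mul]
  congr! 2; ext; ring

theorem trilinear_add_right (u v w w' : Fin 4 → R) :
    trilinear L u v (w + w') = trilinear L u v w + trilinear L u v w' := by
  simp only [trilinear, ← List.sum_map_add, Pi.add_apply]
  congr! 2; ext; ring

theorem trilinear_smul_right (a : R) (u v w : Fin 4 → R) :
    trilinear L u v (a • w) = a * trilinear L u v w := by
  simp only [trilinear, ← List.sum_map_mul_left, Pi.smul_apply, smul_eq_mul]
  congr! 2; ext; ring

theorem map_mixedCoeff {A : Type*} [CommRing A] (φ : R →+* A) (v w : Fin 4 → R) :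
    φ (mixedCoeff L v w) = mixedCoeff L (φ ∘ v) (φ ∘ w) := by
  simp [mixedCoeff, map_trilinear]

theorem trilinear_comb_self (a b : R) (v w : Fin 4 → R) :
    trilinear L (a • v + b • w) (a • v + b • w) (a • v + b • w) =
      a ^ 3 * trilinear L v v v + a ^ 2 * b * mixedCoeff L v w + a * b ^ 2 * mixedCoeff L w v +
        b ^ 3 * trilinear L w w w := by
  simp only [mixedCoeff, trilinear_add_left, trilinear_add_mid, trilinear_add_right,
    trilinear_smul_left, trilinear_smul_mid, trilinear_smul_right]
  ring

variable {L}

theorem VanishesOn.map {A : Type*} [CommRing A] (φ : R →+* A) {v w : Fin 4 → R}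
    (h : VanishesOn L v w) : VanishesOn L (φ ∘ v) (φ ∘ w) := by
  obtain ⟨h1, h2, h3, h4⟩ := h
  simp [VanishesOn, ← map_trilinear, ← map_mixedCoeff, h1, h2, h3, h4]

theorem VanishesOn.of_map {A : Type*} [CommRing A] (φ : R →+* A) (hφ : Function.Injective φ)
    {v w : Fin 4 → R} (h : VanishesOn L (φ ∘ v) (φ ∘ w)) : VanishesOn L v w := by
  simpa [VanishesOn, ← map_trilinear, ← map_mixedCoeff, map_eq_zero_iff φ hφ] using h

theorem VanishesOn.comb {v w : Fin 4 → R} (h : VanishesOn L v w) (a b c d : R) :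
    VanishesOn L (a • v + b • w) (c • v + d • w) := by
  obtain ⟨h1, h2, h3, h4⟩ := h
  refine ⟨?_, ?_, ?_, ?_⟩
  · simp [trilinear_comb_self, h1, h2, h3, h4]
  · simp only [mixedCoeff, trilinear_add_left, trilinear_add_mid, trilinear_add_right,
    trilinear_smul_left, trilinear_smul_mid, trilinear_smul_right]
      at h2 h3 ⊢
    linear_combination 3 * a ^ 2 * c * h1 + (a ^ 2 * d + 2 * a * b * c) * h2 +
      (2 * a * b * d + b ^ 2 * c) * h3 + 3 * b ^ 2 * d * h4
  · simp only [mixedCoeff, trilinear_add_left, trilinear_add_mid, trilinear_add_right,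
    trilinear_smul_left, trilinear_smul_mid, trilinear_smul_right]
      at h2 h3 ⊢
    linear_combination 3 * c ^ 2 * a * h1 + (c ^ 2 * b + 2 * c * d * a) * h2 +
      (2 * c * d * b + d ^ 2 * a) * h3 + 3 * d ^ 2 * b * h4
  · simp [trilinear_comb_self, h1, h2, h3, h4]

end trilinear

section cubicForm

variable (L : List (ℤ × Fin 4 × Fin 4 × Fin 4))

theorem isHomogeneous_cubicForm : (cubicForm L).IsHomogeneous 3 := by
  induction L with
  | nil => simpa [cubicForm, trilinear] using isHomogeneous_zero (Fin 4) ℚ 3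
  | cons m L ih =>
    have h : (((m.1 : MvPolynomial (Fin 4) ℚ) * X m.2.1 * X m.2.2.1 * X m.2.2.2)).IsHomogeneous
        (0 + 1 + 1 + 1) := by
      refine ((IsHomogeneous.mul ?_ (isHomogeneous_X ℚ _)).mul (isHomogeneous_X ℚ _)).mul
        (isHomogeneous_X ℚ _)
      simpa using isHomogeneous_C (Fin 4) (m.1 : ℚ)
    simpa [cubicForm, trilinear] using h.add ih

theorem lineRestrict_cubicForm (v w : Fin 4 → ℚ) :
    lineRestrict (cubicForm L) v w =
      C (trilinear L v v v) * X 0 ^ 3 + C (mixedCoeff L v w) * X 0 ^ 2 * X 1 +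
        C (mixedCoeff L w v) * X 0 * X 1 ^ 2 + C (trilinear L w w w) * X 1 ^ 3 := by
  have h : (fun i => C (v i) * X 0 + C (w i) * X 1 : Fin 4 → MvPolynomial (Fin 2) ℚ) =
      (X 0 : MvPolynomial (Fin 2) ℚ) • (C ∘ v) + (X 1 : MvPolynomial (Fin 2) ℚ) • (C ∘ w) := by
    funext i; simp [mul_comm]
  have hX : ∀ g : Fin 4 → MvPolynomial (Fin 2) ℚ, ((aeval g : MvPolynomial (Fin 4) ℚ →ₐ[ℚ] _) :
      MvPolynomial (Fin 4) ℚ →+* MvPolynomial (Fin 2) ℚ) ∘ X = g := fun g => by funext i; simp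
  have key := map_trilinear L ((aeval fun i => C (v i) * X 0 + C (w i) * X 1 :
      MvPolynomial (Fin 4) ℚ →ₐ[ℚ] MvPolynomial (Fin 2) ℚ) :
      MvPolynomial (Fin 4) ℚ →+* MvPolynomial (Fin 2) ℚ) X X X
  rw [hX, h, trilinear_comb_self] at key
  simp only [map_trilinear, map_mixedCoeff]
  refine Eq.trans ?_ (key.trans (by ring))
  rw [lineRestrict, cubicForm, h]; rfl

theorem lineRestrict_cubicForm_eq_zero_iff (v w : Fin 4 → ℚ) :
    lineRestrict (cubicForm L) v w = 0 ↔ VanishesOn L v w := by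
  rw [lineRestrict_cubicForm]
  constructor
  · intro h
    have ev : ∀ s t : ℚ, trilinear L v v v * s ^ 3 + mixedCoeff L v w * s ^ 2 * t +
        mixedCoeff L w v * s * t ^ 2 + trilinear L w w w * t ^ 3 = 0 := fun s t => by
      simpa using congrArg (eval ![s, t]) h
    have h1 := ev 1 0
    have h2 := ev 0 1
    have h3 := ev 1 1
    have h4 := ev 1 (-1)
    refine ⟨?_, ?_, ?_, ?_⟩ <;> linarith
  · rintro ⟨h1, h2, h3, h4⟩
    simp [h1, h2, h3, h4]

theorem eval_pderiv_cubicForm {K : Type*} [Field K] [Algebra ℚ K] (x : Fin 4 → K) (l : Fin 4) :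
    eval x (map (algebraMap ℚ K) (pderiv l (cubicForm L))) =
      trilinear L (Pi.single l 1) x x + trilinear L x (Pi.single l 1) x +
        trilinear L x x (Pi.single l 1) := by
  induction L with
  | nil => simp [cubicForm, trilinear]
  | cons m L ih =>
    have hs : ∀ i : Fin 4, eval x (map (algebraMap ℚ K) (pderiv l (X i))) =
        (Pi.single l 1 : Fin 4 → K) i := fun i => by
      rw [pderiv_X]; by_cases h : i = l <;> simp [h]
    have hc : pderiv l (m.1 : MvPolynomial (Fin 4) ℚ) = 0 := by
      simp
    simp only [cubicForm, trilinear, List.map_cons, List.sum_cons, map_add] at ih ⊢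
    rw [ih]
    simp only [pderiv_mul, hc, map_add, map_mul, hs, map_X, eval_X, map_intCast, map_zero]
    ring

theorem isSmoothCubic_cubicForm
    (h : ∀ x : Fin 4 → AlgebraicClosure ℚ, (∀ l, trilinear L (Pi.single l 1) x x +
      trilinear L x (Pi.single l 1) x + trilinear L x x (Pi.single l 1) = 0) → x = 0) :
    IsSmoothCubic ℚ (cubicForm L) := by
  refine ⟨fun h0 => ?_, isHomogeneous_cubicForm L, fun x hx => h x fun l => ?_⟩
  · have := h 1 fun l => by rw [← eval_pderiv_cubicForm, h0]; simp
    simpa using congrFun this 0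
  · rw [← eval_pderiv_cubicForm]; exact hx.2 l

end cubicForm

section chart

variable {R : Type*}

/-- The vector with coordinates `x, y, a` at the positions `i, j, k` and `b` at the remaining
position. -/
def chartVec (i j k : Fin 4) (x y a b : R) : Fin 4 → R :=
  fun m => if m = i then x else if m = j then y else if m = k then a else b

/-- The orderings of the four coordinates, up to exchanging the first two or the last two. -/
def charts : List (Fin 4 × Fin 4 × Fin 4 × Fin 4) :=
  [(0, 1, 2, 3), (0, 2, 1, 3), (0, 3, 1, 2), (1, 2, 0, 3), (1, 3, 0, 2), (2, 3, 0, 1)]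

theorem comp_chartVec {A : Type*} (φ : R → A) (i j k : Fin 4) (x y a b : R) :
    φ ∘ chartVec i j k x y a b = chartVec i j k (φ x) (φ y) (φ a) (φ b) := by
  funext m; simp only [Function.comp, chartVec, apply_ite φ]

theorem comb_chartVec [CommRing R] (i j k : Fin 4) (s t x y a b x' y' a' b' : R) :
    s • chartVec i j k x y a b + t • chartVec i j k x' y' a' b' =
      chartVec i j k (s * x + t * x') (s * y + t * y') (s * a + t * a') (s * b + t * b') := by
  funext m; simp only [chartVec, Pi.add_apply, Pi.smul_apply, smul_eq_mul]; split_ifs <;> rfl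

theorem chartVec_self {c : Fin 4 × Fin 4 × Fin 4 × Fin 4} (hc : c ∈ charts) (u : Fin 4 → R) :
    chartVec c.1 c.2.1 c.2.2.1 (u c.1) (u c.2.1) (u c.2.2.1) (u c.2.2.2) = u := by
  simp only [charts, List.mem_cons, List.not_mem_nil, or_false] at hc
  rcases hc with rfl | rfl | rfl | rfl | rfl | rfl <;> funext m <;> fin_cases m <;> rfl

theorem exists_mem_charts : ∀ i j : Fin 4, i ≠ j →
    ∃ c ∈ charts, (c.1 = i ∧ c.2.1 = j) ∨ (c.1 = j ∧ c.2.1 = i) := by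
  decide

end chart

/-- The Plücker coordinates of the plane spanned by `v` and `w`. -/
def plucker {R : Type*} [CommRing R] (v w : Fin 4 → R) (i j : Fin 4) : R :=
  v i * w j - v j * w i

section jacobian

variable {R : Type*} [CommRing R] (L : List (ℤ × Fin 4 × Fin 4 × Fin 4))

/-- The difference quotient of `v ↦ trilinear L v v v` between `v'` and `v` in direction `u`. -/
def cubicQuot (v v' u : Fin 4 → R) : R :=
  trilinear L u v v + trilinear L v' u v + trilinear L v' v' u

/-- The difference quotient of `v ↦ mixedCoeff L v w` between `v'` and `v` in direction `u`. -/
def mixedQuot (v v' w u : Fin 4 → R) : R :=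
  trilinear L u v w + trilinear L v' u w + trilinear L u w v + trilinear L v' w u +
    trilinear L w u v + trilinear L w v' u

/-- The determinant of the matrix with rows `(α, β, 0, 0)`, `(p, q, r, s)`, `(p', q', r', s')`
and `(0, 0, γ, δ)`. -/
def blockDet (α β p q r s p' q' r' s' γ δ : R) : R :=
  (α * q - β * p) * (r' * δ - s' * γ) - (α * q' - β * p') * (r * δ - s * γ)

theorem eq_zero_of_blockDet_ne_zero [IsDomain R] {α β p q r s p' q' r' s' γ δ x y z t : R}
    (h : blockDet α β p q r s p' q' r' s' γ δ ≠ 0) (h1 : x * α + y * β = 0)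
    (h2 : x * p + y * q + (z * r + t * s) = 0) (h3 : z * r' + t * s' + (x * p' + y * q') = 0)
    (h4 : z * γ + t * δ = 0) : x = 0 ∧ y = 0 ∧ z = 0 ∧ t = 0 := by
  refine ⟨?_, ?_, ?_, ?_⟩ <;> refine (mul_eq_zero.1 ?_).resolve_left h <;> unfold blockDet
  · linear_combination (q * (r' * δ - s' * γ) - q' * (r * δ - s * γ)) * h1 -
      β * (r' * δ - s' * γ) * h2 + β * (r * δ - s * γ) * h3 - β * (r * s' - s * r') * h4
  · linear_combination (p' * (r * δ - s * γ) - p * (r' * δ - s' * γ)) * h1 +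
      α * (r' * δ - s' * γ) * h2 - α * (r * δ - s * γ) * h3 + α * (r * s' - s * r') * h4
  · linear_combination δ * (p * q' - q * p') * h1 - δ * (α * q' - β * p') * h2 +
      δ * (α * q - β * p) * h3 + ((α * q' - β * p') * s - (α * q - β * p) * s') * h4
  · linear_combination -γ * (p * q' - q * p') * h1 + γ * (α * q' - β * p') * h2 -
      γ * (α * q - β * p) * h3 - ((α * q' - β * p') * r - (α * q - β * p) * r') * h4

/-- The Jacobian determinant, in a chart, of the four equations defining the lines on the surface,
with derivatives replaced by difference quotients between `(v', w')` and `(v, w)`. -/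
def jacobianDet (v v' w w' e f : Fin 4 → R) : R :=
  blockDet (cubicQuot L v v' e) (cubicQuot L v v' f)
    (mixedQuot L v v' w e) (mixedQuot L v v' w f) (mixedCoeff L v' e) (mixedCoeff L v' f)
    (mixedCoeff L w e) (mixedCoeff L w f) (mixedQuot L w w' v' e) (mixedQuot L w w' v' f)
    (cubicQuot L w w' e) (cubicQuot L w w' f)

theorem map_jacobianDet {A : Type*} [CommRing A] (φ : R →+* A) (v v' w w' e f : Fin 4 → R) :
    φ (jacobianDet L v v' w w' e f) =
      jacobianDet L (φ ∘ v) (φ ∘ v') (φ ∘ w) (φ ∘ w') (φ ∘ e) (φ ∘ f) := by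
  simp [jacobianDet, blockDet, cubicQuot, mixedQuot, map_trilinear, map_mixedCoeff]

theorem VanishesOn.eq_of_jacobianDet_ne_zero [IsDomain R] {L} {v v' w w' e f : Fin 4 → R}
    (h : VanishesOn L v w) (h' : VanishesOn L v' w') {x y z t : R}
    (hv : v = v' + (x • e + y • f)) (hw : w = w' + (z • e + t • f))
    (hJ : jacobianDet L v v' w w' e f ≠ 0) : x = 0 ∧ y = 0 ∧ z = 0 ∧ t = 0 := by
  subst hv hw
  obtain ⟨h1, h2, h3, h4⟩ := h
  obtain ⟨h1', h2', h3', h4'⟩ := h'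
  refine eq_zero_of_blockDet_ne_zero hJ ?_ ?_ ?_ ?_ <;>
    simp only [cubicQuot, mixedQuot, mixedCoeff, trilinear_add_left, trilinear_add_mid,
      trilinear_add_right, trilinear_smul_left, trilinear_smul_mid, trilinear_smul_right]
      at h1 h2 h3 h4 h1' h2' h3' h4' ⊢
  · linear_combination h1 - h1'
  · linear_combination h2 - h2'
  · linear_combination h3 - h3'
  · linear_combination h4 - h4'

end jacobian

section plucker

variable {K : Type*} [Field K]

theorem span_pair_comb {a b c d : K} (h : a * d - b * c ≠ 0) (v w : Fin 4 → K) :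
    Submodule.span K {a • v + b • w, c • v + d • w} = Submodule.span K {v, w} := by
  apply le_antisymm <;> rw [Submodule.span_le, Set.insert_subset_iff, Set.singleton_subset_iff] <;>
    simp only [SetLike.mem_coe, Submodule.mem_span_pair]
  · exact ⟨⟨a, b, rfl⟩, c, d, rfl⟩
  · have hD := mul_inv_cancel₀ h
    refine ⟨⟨d * (a * d - b * c)⁻¹, -b * (a * d - b * c)⁻¹, ?_⟩,
      -c * (a * d - b * c)⁻¹, a * (a * d - b * c)⁻¹, ?_⟩ <;> funext m <;>
      simp only [Pi.add_apply, Pi.smul_apply, smul_eq_mul]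
    · linear_combination v m * hD
    · linear_combination w m * hD

theorem finrank_span_pair_eq_two_iff (v w : Fin 4 → K) :
    Module.finrank K (Submodule.span K {v, w}) = 2 ↔ ∃ i j, plucker v w i j ≠ 0 := by
  have h : Module.finrank K (Submodule.span K {v, w}) = 2 ↔ LinearIndependent K ![v, w] := by
    rw [linearIndependent_iff_card_eq_finrank_span, Matrix.range_cons, Matrix.range_cons,
      Matrix.range_empty, Set.union_empty, Set.singleton_union, Set.finrank, Fintype.card_fin,
      eq_comm]
  rw [h, LinearIndependent.pair_iff]
  constructor
  · intro h
    by_contra! h0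
    have key : ∀ j, w j = 0 ∧ -v j = 0 := fun j => h _ _ (by
      funext m
      have := h0 m j
      simp only [plucker] at this
      simp only [Pi.add_apply, Pi.smul_apply, smul_eq_mul, Pi.zero_apply]
      linear_combination this)
    have := h 1 0 (by funext m; simpa using (key m).2)
    simp at this
  · rintro ⟨i, j, hij⟩ s t hst
    have hi := congrFun hst i
    have hj := congrFun hst j
    simp only [Pi.add_apply, Pi.smul_apply, smul_eq_mul, Pi.zero_apply] at hi hj
    simp only [plucker] at hij
    constructor <;> refine (mul_eq_zero.1 ?_).resolve_left hij
    · linear_combination w j * hi - w i * hj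
    · linear_combination v i * hj - v j * hi

theorem plucker_proportional_of_span_eq {v w v' w' : Fin 4 → K}
    (h : Submodule.span K {v, w} = Submodule.span K {v', w'}) (i j k l : Fin 4) :
    plucker v w i j * plucker v' w' k l = plucker v w k l * plucker v' w' i j := by
  have hv : v ∈ Submodule.span K {v', w'} := h ▸ Submodule.subset_span (by simp)
  have hw : w ∈ Submodule.span K {v', w'} := h ▸ Submodule.subset_span (by simp)
  obtain ⟨a, b, rfl⟩ := Submodule.mem_span_pair.1 hv
  obtain ⟨c, d, rfl⟩ := Submodule.mem_span_pair.1 hw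
  simp only [plucker, Pi.add_apply, Pi.smul_apply, smul_eq_mul]
  ring

end plucker

section reduction

variable (p : ℕ) (L : List (ℤ × Fin 4 × Fin 4 × Fin 4)) (S : List ((Fin 4 → ℤ) × (Fin 4 → ℤ)))

/-- If the line spanned by `v` and `w` lies on the surface modulo `p`, where `v, w` is the reduced
basis in the chart `c`, then it is a simple point of the scheme of lines modulo `p` and the
reduction of a member of `S`. -/
def LiftsTo (c : Fin 4 × Fin 4 × Fin 4 × Fin 4) (v w : Fin 4 → ℤ) : Prop :=
  (p : ℤ) ∣ trilinear L w w w → (p : ℤ) ∣ mixedCoeff L v w → (p : ℤ) ∣ mixedCoeff L w v →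
    (¬ (p : ℤ) ∣ jacobianDet L v v w w (chartVec c.1 c.2.1 c.2.2.1 0 0 1 0)
      (chartVec c.1 c.2.1 c.2.2.1 0 0 0 1)) ∧
    ∃ l ∈ S, (¬ (p : ℤ) ∣ plucker l.1 l.2 c.1 c.2.1) ∧
      ∀ m, (p : ℤ) ∣ l.1 m - (l.1 c.1 * v m + l.1 c.2.1 * w m) ∧
        (p : ℤ) ∣ l.2 m - (l.2 c.1 * v m + l.2 c.2.1 * w m)

instance (c : Fin 4 × Fin 4 × Fin 4 × Fin 4) (v w : Fin 4 → ℤ) :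
    Decidable (LiftsTo p L S c v w) := by
  unfold LiftsTo; infer_instance

/-- All lines modulo `p` on the surface are simple and are reductions of members of `S`. -/
def AllLinesLift : Prop :=
  ∀ c ∈ charts, ∀ a ∈ List.range p, ∀ b ∈ List.range p,
    (p : ℤ) ∣ trilinear L (chartVec c.1 c.2.1 c.2.2.1 1 0 (a : ℤ) b)
      (chartVec c.1 c.2.1 c.2.2.1 1 0 (a : ℤ) b) (chartVec c.1 c.2.1 c.2.2.1 1 0 (a : ℤ) b) →
    ∀ a' ∈ List.range p, ∀ b' ∈ List.range p, LiftsTo p L S c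
      (chartVec c.1 c.2.1 c.2.2.1 1 0 (a : ℤ) b) (chartVec c.1 c.2.1 c.2.2.1 0 1 (a' : ℤ) b')

instance : Decidable (AllLinesLift p L S) := by
  unfold AllLinesLift; infer_instance

variable {p L S}

theorem VanishesOn.exists_chart_basis (p : ℕ) [Fact p.Prime] {v w : Fin 4 → ℚ}
    (h : VanishesOn L v w) (hvw : ∃ i j, plucker v w i j ≠ 0) :
    ∃ c ∈ charts, ∃ a b a' b' : ℚ, (‖(a : ℚ_[p])‖ ≤ 1 ∧ ‖(b : ℚ_[p])‖ ≤ 1 ∧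
      ‖(a' : ℚ_[p])‖ ≤ 1 ∧ ‖(b' : ℚ_[p])‖ ≤ 1) ∧
      VanishesOn L (chartVec c.1 c.2.1 c.2.2.1 1 0 a b) (chartVec c.1 c.2.1 c.2.2.1 0 1 a' b') ∧
      Submodule.span ℚ {chartVec c.1 c.2.1 c.2.2.1 1 0 a b,
        chartVec c.1 c.2.1 c.2.2.1 0 1 a' b'} = Submodule.span ℚ {v, w} := by
  have antisymm : ∀ i j, plucker v w i j = -plucker v w j i := fun i j => by
    simp only [plucker]; ring
  obtain ⟨⟨i, j⟩, hmax⟩ := Finite.exists_max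
    fun q : Fin 4 × Fin 4 => ‖((plucker v w q.1 q.2 : ℚ) : ℚ_[p])‖
  obtain ⟨i', j', hij'⟩ := hvw
  have hij : plucker v w i j ≠ 0 := fun h0 => by
    have := hmax (i', j')
    simp only [h0, Rat.cast_zero, norm_zero, norm_le_zero_iff, Rat.cast_eq_zero] at this
    exact hij' this
  obtain ⟨c, hc, hcij⟩ := exists_mem_charts i j fun h0 => hij (by simp [plucker, h0])
  have hP : plucker v w c.1 c.2.1 ≠ 0 := by
    rcases hcij with ⟨h1, h2⟩ | ⟨h1, h2⟩
    · rwa [h1, h2]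
    · rw [h1, h2, antisymm]; simpa using hij
  have hmax' : ∀ m n, ‖((plucker v w m n / plucker v w c.1 c.2.1 : ℚ) : ℚ_[p])‖ ≤ 1 :=
    fun m n => by
      rw [Rat.cast_div, norm_div]
      refine div_le_one_of_le₀ ?_ (norm_nonneg _)
      rcases hcij with ⟨h1, h2⟩ | ⟨h1, h2⟩
      · rw [h1, h2]; exact hmax (m, n)
      · rw [h1, h2, antisymm j i, Rat.cast_neg, norm_neg]; exact hmax (m, n)
  set P := plucker v w c.1 c.2.1 with hPdef
  have hv' : (w c.2.1 / P) • v + (-v c.2.1 / P) • w = chartVec c.1 c.2.1 c.2.2.1 1 0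
      (plucker v w c.2.2.1 c.2.1 / P) (plucker v w c.2.2.2 c.2.1 / P) := by
    rw [← chartVec_self hc ((w c.2.1 / P) • v + (-v c.2.1 / P) • w)]
    congr 1 <;> simp only [Pi.add_apply, Pi.smul_apply, smul_eq_mul] <;> field_simp <;>
      simp only [hPdef, plucker] <;> ring
  have hw' : (-w c.1 / P) • v + (v c.1 / P) • w = chartVec c.1 c.2.1 c.2.2.1 0 1
      (plucker v w c.1 c.2.2.1 / P) (plucker v w c.1 c.2.2.2 / P) := by
    rw [← chartVec_self hc ((-w c.1 / P) • v + (v c.1 / P) • w)]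
    congr 1 <;> simp only [Pi.add_apply, Pi.smul_apply, smul_eq_mul] <;> field_simp <;>
      simp only [hPdef, plucker] <;> ring
  refine ⟨c, hc, plucker v w c.2.2.1 c.2.1 / P, plucker v w c.2.2.2 c.2.1 / P,
    plucker v w c.1 c.2.2.1 / P, plucker v w c.1 c.2.2.2 / P,
    ⟨hmax' _ _, hmax' _ _, hmax' _ _, hmax' _ _⟩, ?_, ?_⟩
  · rw [← hv', ← hw']; exact h.comb _ _ _ _
  · rw [← hv', ← hw']
    refine span_pair_comb ?_ v w
    have : w c.2.1 / P * (v c.1 / P) - -v c.2.1 / P * (-w c.1 / P) = P⁻¹ := by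
      field_simp; simp only [hPdef, plucker]; ring
    rw [this]; exact inv_ne_zero hP

theorem AllLinesLift.exists_padic_basis [Fact p.Prime] (hS : AllLinesLift p L S)
    (hL : ∀ l ∈ S, VanishesOn L l.1 l.2) {c : Fin 4 × Fin 4 × Fin 4 × Fin 4} (hc : c ∈ charts)
    {a b a' b' : ℤ_[p]} (h : VanishesOn L (chartVec c.1 c.2.1 c.2.2.1 1 0 a b)
      (chartVec c.1 c.2.1 c.2.2.1 0 1 a' b')) :
    ∃ l ∈ S, plucker l.1 l.2 c.1 c.2.1 ≠ 0 ∧ ∀ m,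
      (l.1 m : ℤ_[p]) = l.1 c.1 * chartVec c.1 c.2.1 c.2.2.1 1 0 a b m +
        l.1 c.2.1 * chartVec c.1 c.2.1 c.2.2.1 0 1 a' b' m ∧
      (l.2 m : ℤ_[p]) = l.2 c.1 * chartVec c.1 c.2.1 c.2.2.1 1 0 a b m +
        l.2 c.2.1 * chartVec c.1 c.2.1 c.2.2.1 0 1 a' b' m := by
  set φ : ℤ_[p] →+* ZMod p := PadicInt.toZMod
  set ψ : ℤ →+* ZMod p := Int.castRingHom (ZMod p)
  have hψ : ∀ n : ℤ, (p : ℤ) ∣ n ↔ ψ n = 0 := fun n =>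
    (ZMod.intCast_zmod_eq_zero_iff_dvd n p).symm
  have hrep : ∀ x : ℤ_[p], ((φ x).val ∈ List.range p) ∧ ψ ((φ x).val : ℤ) = φ x := fun x =>
    ⟨List.mem_range.2 (ZMod.val_lt _), by simp [ψ]⟩
  have hv : ψ ∘ chartVec c.1 c.2.1 c.2.2.1 1 0 ((φ a).val : ℤ) (φ b).val =
      φ ∘ chartVec c.1 c.2.1 c.2.2.1 1 0 a b := by
    simp only [comp_chartVec, (hrep _).2, map_one, map_zero]
  have hw : ψ ∘ chartVec c.1 c.2.1 c.2.2.1 0 1 ((φ a').val : ℤ) (φ b').val =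
      φ ∘ chartVec c.1 c.2.1 c.2.2.1 0 1 a' b' := by
    simp only [comp_chartVec, (hrep _).2, map_one, map_zero]
  have key := hS c hc _ (hrep a).1 _ (hrep b).1
  simp only [LiftsTo, hψ, map_trilinear, map_mixedCoeff, map_jacobianDet, hv] at key
  simp only [← map_trilinear] at key
  replace key := key (by rw [h.1, map_zero]) _ (hrep a').1 _ (hrep b').1
  simp only [map_trilinear, hw] at key
  simp only [← map_trilinear, ← map_mixedCoeff] at key
  obtain ⟨hJ, l, hl, hP, hlm⟩ := key (by rw [h.2.2.2, map_zero]) (by rw [h.2.1, map_zero])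
    (by rw [h.2.2.1, map_zero])
  have hm : IsUnit ((plucker l.1 l.2 c.1 c.2.1 : ℤ) : ℤ_[p]) := by
    rw [PadicInt.isUnit_iff]
    refine le_antisymm (PadicInt.norm_le_one _) (not_lt.1 fun hlt => hP ?_)
    rw [← hψ]
    exact (PadicInt.norm_int_lt_one_iff_dvd _).1 hlt
  obtain ⟨u, hu⟩ := hm.exists_left_inv
  have hφ : ∀ n : ℤ, ψ n = φ n := fun n => by simp [ψ]
  have hφu := congrArg φ hu
  simp only [plucker, Int.cast_sub, Int.cast_mul] at hu
  simp only [plucker, Int.cast_sub, Int.cast_mul, map_mul, map_sub, map_one] at hφu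
  set V := chartVec c.1 c.2.1 c.2.2.1 1 0 a b with hV
  set W := chartVec c.1 c.2.1 c.2.2.1 0 1 a' b' with hW
  have hvm := fun m => congrFun hv m
  have hwm := fun m => congrFun hw m
  simp only [Function.comp] at hvm hwm
  simp only [map_sub, map_add, map_mul, hvm, hwm] at hlm
  simp only [hφ] at hlm
  clear key
  set V' : Fin 4 → ℤ_[p] := (u * l.2 c.2.1) • (Int.castRingHom ℤ_[p] ∘ l.1) +
    (-u * l.1 c.2.1) • (Int.castRingHom ℤ_[p] ∘ l.2) with hV'
  set W' : Fin 4 → ℤ_[p] := (-u * l.2 c.1) • (Int.castRingHom ℤ_[p] ∘ l.1) +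
    (u * l.1 c.1) • (Int.castRingHom ℤ_[p] ∘ l.2) with hW'
  have hVm : ∀ m, V' m = u * l.2 c.2.1 * l.1 m + -u * l.1 c.2.1 * l.2 m := fun m => by
    simp [hV']
  have hWm : ∀ m, W' m = -u * l.2 c.1 * l.1 m + u * l.1 c.1 * l.2 m := fun m => by
    simp [hW']
  have hvan : VanishesOn L V' W' := ((hL l hl).map _).comb _ _ _ _
  have hφV : φ ∘ V' = φ ∘ V := by
    funext m
    simp only [Function.comp, hVm, map_add, map_mul, map_neg]
    linear_combination φ u * φ (l.2 c.2.1) * (hlm m).1 - φ u * φ (l.1 c.2.1) * (hlm m).2 +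
      φ (V m) * hφu
  have hφW : φ ∘ W' = φ ∘ W := by
    funext m
    simp only [Function.comp, hWm, map_add, map_mul, map_neg]
    linear_combination -φ u * φ (l.2 c.1) * (hlm m).1 + φ u * φ (l.1 c.1) * (hlm m).2 +
      φ (W m) * hφu
  have hVeq : V = V' + ((a - V' c.2.2.1) • chartVec c.1 c.2.1 c.2.2.1 0 0 1 0 +
      (b - V' c.2.2.2) • chartVec c.1 c.2.1 c.2.2.1 0 0 0 1) := by
    rw [comb_chartVec]
    nth_rw 1 [← chartVec_self hc V']
    rw [← one_smul ℤ_[p] (chartVec _ _ _ (V' _) _ _ _),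
      ← one_smul ℤ_[p] (chartVec _ _ _ (_ + _) _ _ _), comb_chartVec, hV]
    congr 1 <;> simp only [hVm] <;> first | ring1 | linear_combination -hu
  have hWeq : W = W' + ((a' - W' c.2.2.1) • chartVec c.1 c.2.1 c.2.2.1 0 0 1 0 +
      (b' - W' c.2.2.2) • chartVec c.1 c.2.1 c.2.2.1 0 0 0 1) := by
    rw [comb_chartVec]
    nth_rw 1 [← chartVec_self hc W']
    rw [← one_smul ℤ_[p] (chartVec _ _ _ (W' _) _ _ _),
      ← one_smul ℤ_[p] (chartVec _ _ _ (_ + _) _ _ _), comb_chartVec, hW]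
    congr 1 <;> simp only [hWm] <;> first | ring1 | linear_combination -hu
  obtain ⟨h1, h2, h3, h4⟩ := h.eq_of_jacobianDet_ne_zero hvan hVeq hWeq fun h0 => hJ (by
    rw [← map_zero φ, ← h0, map_jacobianDet, hφV, hφW]
    simp only [comp_chartVec, map_zero, map_one])
  rw [h1, h2, zero_smul, zero_smul, add_zero, add_zero] at hVeq
  rw [h3, h4, zero_smul, zero_smul, add_zero, add_zero] at hWeq
  refine ⟨l, hl, fun h0 => hP (by rw [h0, map_zero]), fun m => ?_⟩
  rw [hVeq, hWeq, hVm, hWm]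
  constructor
  · linear_combination -l.1 m * hu
  · linear_combination -l.2 m * hu

end reduction

section count

variable {p : ℕ} {L : List (ℤ × Fin 4 × Fin 4 × Fin 4)} {S : List ((Fin 4 → ℤ) × (Fin 4 → ℤ))}

/-- The rational plane spanned by a pair of integer vectors. -/
def ratSpan (l : (Fin 4 → ℤ) × (Fin 4 → ℤ)) : Submodule ℚ (Fin 4 → ℚ) :=
  Submodule.span ℚ {Int.castRingHom ℚ ∘ l.1, Int.castRingHom ℚ ∘ l.2}

theorem plucker_intCast (l : (Fin 4 → ℤ) × (Fin 4 → ℤ)) (i j : Fin 4) :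
    plucker (Int.castRingHom ℚ ∘ l.1) (Int.castRingHom ℚ ∘ l.2) i j =
      (plucker l.1 l.2 i j : ℤ) := by
  simp [plucker]

theorem isLineOn_ratSpan {l : (Fin 4 → ℤ) × (Fin 4 → ℤ)} (hl : VanishesOn L l.1 l.2)
    (h : ∃ i j, plucker l.1 l.2 i j ≠ 0) : IsLineOn (cubicForm L) (ratSpan l) := by
  refine ⟨(finrank_span_pair_eq_two_iff _ _).2 ?_, _, _, rfl,
    (lineRestrict_cubicForm_eq_zero_iff L _ _).2 (hl.map _)⟩
  obtain ⟨i, j, hij⟩ := h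
  exact ⟨i, j, by rw [plucker_intCast]; exact_mod_cast hij⟩

theorem AllLinesLift.exists_ratSpan_eq [Fact p.Prime] (hS : AllLinesLift p L S)
    (hL : ∀ l ∈ S, VanishesOn L l.1 l.2) {W : Submodule ℚ (Fin 4 → ℚ)}
    (hW : IsLineOn (cubicForm L) W) : ∃ l ∈ S, ratSpan l = W := by
  obtain ⟨hrank, v, w, rfl, hvw⟩ := hW
  obtain ⟨c, hc, a, b, a', b', ⟨ha, hb, ha', hb'⟩, hvan, hspan⟩ :=
    ((lineRestrict_cubicForm_eq_zero_iff L v w).1 hvw).exists_chart_basis p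
      ((finrank_span_pair_eq_two_iff v w).1 hrank)
  obtain ⟨α, hα⟩ : ∃ α : ℤ_[p], PadicInt.Coe.ringHom α = (a : ℚ_[p]) := ⟨⟨a, ha⟩, rfl⟩
  obtain ⟨β, hβ⟩ : ∃ β : ℤ_[p], PadicInt.Coe.ringHom β = (b : ℚ_[p]) := ⟨⟨b, hb⟩, rfl⟩
  obtain ⟨α', hα'⟩ : ∃ α' : ℤ_[p], PadicInt.Coe.ringHom α' = (a' : ℚ_[p]) := ⟨⟨a', ha'⟩, rfl⟩
  obtain ⟨β', hβ'⟩ : ∃ β' : ℤ_[p], PadicInt.Coe.ringHom β' = (b' : ℚ_[p]) := ⟨⟨b', hb'⟩, rfl⟩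
  have hV : PadicInt.Coe.ringHom ∘ chartVec c.1 c.2.1 c.2.2.1 1 0 α β =
      Rat.castHom ℚ_[p] ∘ chartVec c.1 c.2.1 c.2.2.1 1 0 a b := by
    simp only [comp_chartVec, map_zero, map_one, hα, hβ, Rat.coe_castHom,
      Rat.cast_zero, Rat.cast_one]
  have hW : PadicInt.Coe.ringHom ∘ chartVec c.1 c.2.1 c.2.2.1 0 1 α' β' =
      Rat.castHom ℚ_[p] ∘ chartVec c.1 c.2.1 c.2.2.1 0 1 a' b' := by
    simp only [comp_chartVec, map_zero, map_one, hα', hβ', Rat.coe_castHom,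
      Rat.cast_zero, Rat.cast_one]
  have hvan' : VanishesOn L (chartVec c.1 c.2.1 c.2.2.1 1 0 α β)
      (chartVec c.1 c.2.1 c.2.2.1 0 1 α' β') :=
    VanishesOn.of_map PadicInt.Coe.ringHom Subtype.val_injective (by
      rw [hV, hW]; exact hvan.map _)
  obtain ⟨l, hl, hP, hlm⟩ := hS.exists_padic_basis hL hc hvan'
  have key : ∀ (n : Fin 4 → ℤ) (i j : Fin 4), (∀ m, (n m : ℤ_[p]) =
      n i * chartVec c.1 c.2.1 c.2.2.1 1 0 α β m +
      n j * chartVec c.1 c.2.1 c.2.2.1 0 1 α' β' m) →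
      Int.castRingHom ℚ ∘ n = (n i : ℚ) • chartVec c.1 c.2.1 c.2.2.1 1 0 a b +
        (n j : ℚ) • chartVec c.1 c.2.1 c.2.2.1 0 1 a' b' := by
    intro n i j h
    funext m
    have hVm := congrFun hV m
    have hWm := congrFun hW m
    have hm := congrArg PadicInt.Coe.ringHom (h m)
    simp only [Function.comp, Rat.coe_castHom] at hVm hWm
    simp only [map_add, map_mul, map_intCast, hVm, hWm] at hm
    simp only [Function.comp, Int.coe_castRingHom, Pi.add_apply, Pi.smul_apply, smul_eq_mul]
    exact_mod_cast hm
  refine ⟨l, hl, ?_⟩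
  rw [ratSpan, key l.1 c.1 c.2.1 fun m => (hlm m).1, key l.2 c.1 c.2.1 fun m => (hlm m).2,
    span_pair_comb (by unfold plucker at hP; exact_mod_cast hP), hspan]

/-- A surface whose lines modulo `p` are simple and lift to the given list of integer lines
has exactly these lines over `ℚ`. -/
theorem exists_smooth_cubic_of_allLinesLift (p : ℕ) [Fact p.Prime]
    (L : List (ℤ × Fin 4 × Fin 4 × Fin 4)) (S : List ((Fin 4 → ℤ) × (Fin 4 → ℤ)))
    (hsmooth : ∀ a b c d : AlgebraicClosure ℚ,
      (∀ l, trilinear L (Pi.single l 1) ![a, b, c, d] ![a, b, c, d] +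
        trilinear L ![a, b, c, d] (Pi.single l 1) ![a, b, c, d] +
        trilinear L ![a, b, c, d] ![a, b, c, d] (Pi.single l 1) = 0) →
      a = 0 ∧ b = 0 ∧ c = 0 ∧ d = 0)
    (hS : AllLinesLift p L S) (hL : ∀ l ∈ S, VanishesOn L l.1 l.2)
    (hrank : ∀ l ∈ S, ∃ i j, plucker l.1 l.2 i j ≠ 0)
    (hne : S.Pairwise fun l l' => ∃ i j k m, plucker l.1 l.2 i j * plucker l'.1 l'.2 k m ≠
      plucker l.1 l.2 k m * plucker l'.1 l'.2 i j) :
    ∃ f : MvPolynomial (Fin 4) ℚ, IsSmoothCubic ℚ f ∧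
      {W : Submodule ℚ (Fin 4 → ℚ) | IsLineOn f W}.Finite ∧
      {W : Submodule ℚ (Fin 4 → ℚ) | IsLineOn f W}.ncard = S.length := by
  classical
  have hset : {W : Submodule ℚ (Fin 4 → ℚ) | IsLineOn (cubicForm L) W} =
      ((S.map ratSpan).toFinset : Set (Submodule ℚ (Fin 4 → ℚ))) := by
    ext W
    simp only [Set.mem_ofPred_eq, List.coe_toFinset, List.mem_map]
    refine ⟨hS.exists_ratSpan_eq hL, ?_⟩
    rintro ⟨l, hl, rfl⟩
    exact isLineOn_ratSpan (hL l hl) (hrank l hl)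
  have hnodup : (S.map ratSpan).Nodup := by
    rw [List.Nodup, List.pairwise_map]
    refine hne.imp ?_
    rintro l l' ⟨i, j, k, m, h⟩ heq
    have := plucker_proportional_of_span_eq heq i j k m
    simp only [plucker_intCast] at this
    exact h (by exact_mod_cast this)
  refine ⟨cubicForm L, isSmoothCubic_cubicForm L fun x hx => ?_, ?_, ?_⟩
  · have hx' : x = ![x 0, x 1, x 2, x 3] := by funext m; fin_cases m <;> rfl
    rw [hx'] at hx
    obtain ⟨h0, h1, h2, h3⟩ := hsmooth _ _ _ _ hx
    funext m
    fin_cases m <;> assumption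
  · rw [hset]; exact Finset.finite_toSet _
  · rw [hset, Set.ncard_coe_finset, List.toFinset_card_of_nodup hnodup, List.length_map]

end count

theorem exists_smooth_cubic_rat_with_no_line :
    ∃ f : MvPolynomial (Fin 4) ℚ, IsSmoothCubic ℚ f ∧
      {W : Submodule ℚ (Fin 4 → ℚ) | IsLineOn f W}.Finite ∧
      {W : Submodule ℚ (Fin 4 → ℚ) | IsLineOn f W}.ncard = 0 := by
  refine exists_smooth_cubic_of_allLinesLift 2 [(1, 0, 0, 1), (1, 0, 1, 1), (1, 2, 2, 2), (1, 2, 2,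
    3), (1, 3, 3, 3)] [] ?_ (by decide +kernel) (by decide +kernel) (by decide +kernel)
    (by decide +kernel)
  intro a b c d h
  have h0 := h 0
  have h1 := h 1
  have h2 := h 2
  have h3 := h 3
  simp [trilinear, Pi.single_apply, -mul_eq_zero] at h0 h1 h2 h3
  obtain rfl : a = 0 := by
    refine pow_eq_zero_iff (n := 3) (by decide) |>.1 ?_
    linear_combination -4 / 3 * a * h0 + (2 / 3 * b + a) * h1
  obtain rfl : b = 0 := by
    refine pow_eq_zero_iff (n := 2) (by decide) |>.1 ?_
    linear_combination h0
  obtain rfl : c = 0 := by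
    refine pow_eq_zero_iff (n := 3) (by decide) |>.1 ?_
    linear_combination (-6 / 31 * d + 9 / 31 * c) * h2 + 4 / 31 * c * h3
  obtain rfl : d = 0 := by
    refine pow_eq_zero_iff (n := 2) (by decide) |>.1 ?_
    linear_combination 1 / 3 * h3
  exact ⟨rfl, rfl, rfl, rfl⟩

theorem exists_smooth_cubic_rat_with_one_line :
    ∃ f : MvPolynomial (Fin 4) ℚ, IsSmoothCubic ℚ f ∧
      {W : Submodule ℚ (Fin 4 → ℚ) | IsLineOn f W}.Finite ∧
      {W : Submodule ℚ (Fin 4 → ℚ) | IsLineOn f W}.ncard = 1 := by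
  refine exists_smooth_cubic_of_allLinesLift 2 [(-1, 2, 2, 2), (-1, 1, 1, 1), (-1, 2, 3, 3), (1, 1,
    2, 2), (1, 0, 0, 0), (1, 2, 2, 3)] [(![1, 1, 0, 0], ![0, 0, 0, 1])] ?_ (by decide +kernel)
    (by decide +kernel) (by decide +kernel) (by decide +kernel)
  intro a b c d h
  have h0 := h 0
  have h1 := h 1
  have h2 := h 2
  have h3 := h 3
  simp [trilinear, Pi.single_apply, -mul_eq_zero] at h0 h1 h2 h3
  obtain rfl : a = 0 := by
    refine pow_eq_zero_iff (n := 2) (by decide) |>.1 ?_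
    linear_combination 1 / 3 * h0
  obtain rfl : b = 0 := by
    refine pow_eq_zero_iff (n := 4) (by decide) |>.1 ?_
    linear_combination (9 / 179 * d ^ 2 - 18 / 179 * b * c - 1 / 3 * b ^ 2 - 18 / 179 * c * d) * h1
      + (-32 / 537 * b * c - 6 / 179 * c * d - 27 / 179 * b ^ 2) * h2 + (3 / 179 * d ^ 2 + 16 / 537
      * b * d - 14 / 179 * b * c) * h3
  obtain rfl : c = 0 := by
    refine pow_eq_zero_iff (n := 2) (by decide) |>.1 ?_
    linear_combination h1
  obtain rfl : d = 0 := by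
    refine pow_eq_zero_iff (n := 2) (by decide) |>.1 ?_
    linear_combination -h2
  exact ⟨rfl, rfl, rfl, rfl⟩

theorem exists_smooth_cubic_rat_with_two_lines :
    ∃ f : MvPolynomial (Fin 4) ℚ, IsSmoothCubic ℚ f ∧
      {W : Submodule ℚ (Fin 4 → ℚ) | IsLineOn f W}.Finite ∧
      {W : Submodule ℚ (Fin 4 → ℚ) | IsLineOn f W}.ncard = 2 := by
  refine exists_smooth_cubic_of_allLinesLift 2 [(1, 0, 3, 3), (-1, 1, 2, 3), (-1, 0, 0, 2), (-1, 1,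
    2, 2), (1, 0, 1, 3), (1, 1, 1, 3)] [(![1, 0, 0, 0], ![0, 1, 0, 0]), (![0, 0, 1, 0], ![0, 0, 0,
    1])] ?_ (by decide +kernel) (by decide +kernel) (by decide +kernel) (by decide +kernel)
  intro a b c d h
  have h0 := h 0
  have h1 := h 1
  have h2 := h 2
  have h3 := h 3
  simp [trilinear, Pi.single_apply, -mul_eq_zero] at h0 h1 h2 h3
  obtain rfl : a = 0 := by
    refine pow_eq_zero_iff (n := 5) (by decide) |>.1 ?_
    linear_combination (56 / 141 * a * c * d + 4 / 47 * a * c ^ 2 - 46 / 47 * b * c ^ 2 + a ^ 2 * b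
      + 58 / 47 * b ^ 2 * d - 34 / 47 * b * c * d + 17 / 47 * a * b * c + 122 / 141 * a * b * d) *
      h0 + (19 / 282 * a ^ 2 * c + 68 / 47 * b ^ 2 * c + 431 / 282 * b * c * d + 11 / 47 * a * b *
      d + 67 / 141 * b * c ^ 2 + 14 / 141 * b ^ 2 * d + 92 / 47 * a * b * c) * h1 + (-a ^ 3 - 67 /
      282 * c ^ 3 - 34 / 47 * b * c ^ 2 - 81 / 94 * c ^ 2 * d - 34 / 47 * c * d ^ 2 + a * b * d +
      19 / 282 * a * c * d + b ^ 2 * d + 58 / 47 * b * d ^ 2) * h2 + (-28 / 141 * c * d ^ 2 - 61 /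
      141 * b * d ^ 2 - 2 / 47 * c ^ 2 * d - 42 / 47 * b * c * d - 17 / 47 * a * c * d) * h3
  obtain rfl : b = 0 := by
    refine pow_eq_zero_iff (n := 3) (by decide) |>.1 ?_
    linear_combination -1 / 3 * b * h1 + (1 / 6 * c - 1 / 2 * b) * h2 + (b + 1 / 6 * d) * h3
  obtain rfl : d = 0 := by
    refine pow_eq_zero_iff (n := 2) (by decide) |>.1 ?_
    linear_combination h0
  obtain rfl : c = 0 := by
    refine pow_eq_zero_iff (n := 2) (by decide) |>.1 ?_
    linear_combination -h1
  exact ⟨rfl, rfl, rfl, rfl⟩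

theorem exists_smooth_cubic_rat_with_three_lines :
    ∃ f : MvPolynomial (Fin 4) ℚ, IsSmoothCubic ℚ f ∧
      {W : Submodule ℚ (Fin 4 → ℚ) | IsLineOn f W}.Finite ∧
      {W : Submodule ℚ (Fin 4 → ℚ) | IsLineOn f W}.ncard = 3 := by
  refine exists_smooth_cubic_of_allLinesLift 2 [(1, 0, 0, 1), (1, 0, 1, 1), (1, 2, 2, 2), (1, 3, 3,
    3)] [(![1, 0, 0, 0], ![0, 0, 1, -1]), (![1, -1, 0, 0], ![0, 0, 1, -1]), (![0, 1, 0, 0], ![0, 0,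
    1, -1])] ?_ (by decide +kernel) (by decide +kernel) (by decide +kernel) (by decide +kernel)
  intro a b c d h
  have h0 := h 0
  have h1 := h 1
  have h2 := h 2
  have h3 := h 3
  simp [trilinear, Pi.single_apply, -mul_eq_zero] at h0 h1 h2 h3
  obtain rfl : c = 0 := by
    refine pow_eq_zero_iff (n := 2) (by decide) |>.1 ?_
    linear_combination 1 / 3 * h2
  obtain rfl : d = 0 := by
    refine pow_eq_zero_iff (n := 2) (by decide) |>.1 ?_
    linear_combination 1 / 3 * h3
  obtain rfl : a = 0 := by
    refine pow_eq_zero_iff (n := 3) (by decide) |>.1 ?_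
    linear_combination -4 / 3 * a * h0 + (2 / 3 * b + a) * h1
  obtain rfl : b = 0 := by
    refine pow_eq_zero_iff (n := 2) (by decide) |>.1 ?_
    linear_combination h0
  exact ⟨rfl, rfl, rfl, rfl⟩

theorem exists_smooth_cubic_rat_with_five_lines :
    ∃ f : MvPolynomial (Fin 4) ℚ, IsSmoothCubic ℚ f ∧
      {W : Submodule ℚ (Fin 4 → ℚ) | IsLineOn f W}.Finite ∧
      {W : Submodule ℚ (Fin 4 → ℚ) | IsLineOn f W}.ncard = 5 := by
  refine exists_smooth_cubic_of_allLinesLift 2 [(1, 0, 0, 3), (-1, 2, 3, 3), (-1, 1, 2, 2), (1, 0,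
    1, 1)] [(![1, 0, 1, 0], ![0, 1, 0, 1]), (![1, 0, -1, 0], ![0, 1, -1, 1]), (![1, 0, 1, 1], ![0,
    1, 0, -1]), (![1, 0, 0, 0], ![0, 0, 1, 0]), (![0, 1, 0, 0], ![0, 0, 0, 1])] ?_
    (by decide +kernel) (by decide +kernel) (by decide +kernel) (by decide +kernel)
  intro a b c d h
  have h0 := h 0
  have h1 := h 1
  have h2 := h 2
  have h3 := h 3
  simp [trilinear, Pi.single_apply, -mul_eq_zero] at h0 h1 h2 h3
  obtain rfl : a = 0 := by
    refine pow_eq_zero_iff (n := 4) (by decide) |>.1 ?_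
    linear_combination 16 / 15 * a * c * h0 + -8 / 15 * b * c * h1 + 4 / 15 * c ^ 2 * h2 + (a ^ 2 -
      2 / 15 * c * d) * h3
  obtain rfl : b = 0 := by
    refine pow_eq_zero_iff (n := 2) (by decide) |>.1 ?_
    linear_combination h0
  obtain rfl : c = 0 := by
    refine pow_eq_zero_iff (n := 2) (by decide) |>.1 ?_
    linear_combination -h1
  obtain rfl : d = 0 := by
    refine pow_eq_zero_iff (n := 2) (by decide) |>.1 ?_
    linear_combination -h2
  exact ⟨rfl, rfl, rfl, rfl⟩

theorem exists_smooth_cubic_rat_with_seven_lines :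
    ∃ f : MvPolynomial (Fin 4) ℚ, IsSmoothCubic ℚ f ∧
      {W : Submodule ℚ (Fin 4 → ℚ) | IsLineOn f W}.Finite ∧
      {W : Submodule ℚ (Fin 4 → ℚ) | IsLineOn f W}.ncard = 7 := by
  have : Fact (Nat.Prime 5) := ⟨by norm_num⟩
  refine exists_smooth_cubic_of_allLinesLift 5 [(-1, 0, 3, 3), (1, 0, 0, 3), (-1, 1, 1, 2), (-1, 0,
    2, 2), (-1, 1, 2, 2), (-1, 0, 0, 2)] [(![1, 0, 0, 0], ![0, 1, 0, 0]), (![1, 0, 0, 1], ![0, 1,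
    0, 0]), (![1, 0, -1, 0], ![0, 1, 0, 1]), (![1, 0, -1, 1], ![0, 1, 0, -1]), (![0, 1, 0, 0], ![0,
    0, 0, 1]), (![0, 1, -1, 0], ![0, 0, 0, 1]), (![0, 0, 1, 0], ![0, 0, 0, 1])] ?_
    (by decide +kernel) (by decide +kernel) (by decide +kernel) (by decide +kernel)
  intro a b c d h
  have h0 := h 0
  have h1 := h 1
  have h2 := h 2
  have h3 := h 3
  simp [trilinear, Pi.single_apply, -mul_eq_zero] at h0 h1 h2 h3
  obtain rfl : a = 0 := by
    refine pow_eq_zero_iff (n := 5) (by decide) |>.1 ?_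
    linear_combination (352 / 147 * a ^ 2 * d + 80 / 147 * a * d ^ 2 + 544 / 441 * a ^ 2 * c - 80 /
      147 * a * c ^ 2) * h0 + (80 / 147 * a * c ^ 2 + 64 / 49 * a ^ 2 * c + 256 / 147 * a ^ 3 + 160
      / 441 * a * b * c - 512 / 147 * a ^ 2 * d + 128 / 147 * a ^ 2 * b) * h1 + (-320 / 441 * a * c
      ^ 2 - 256 / 147 * a ^ 2 * c) * h2 + (-40 / 147 * d ^ 3 + a ^ 3 - 116 / 147 * a * d ^ 2 - 256
      / 147 * a ^ 2 * c + 2 * a ^ 2 * d - 512 / 441 * a * c * d + 512 / 147 * a * b * c) * h3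
  obtain rfl : b = 0 := by
    refine pow_eq_zero_iff (n := 3) (by decide) |>.1 ?_
    linear_combination 4 / 3 * b * h1 + (-2 / 3 * c - b) * h2
  obtain rfl : c = 0 := by
    refine pow_eq_zero_iff (n := 2) (by decide) |>.1 ?_
    linear_combination -h1
  obtain rfl : d = 0 := by
    refine pow_eq_zero_iff (n := 2) (by decide) |>.1 ?_
    linear_combination -h0
  exact ⟨rfl, rfl, rfl, rfl⟩

theorem exists_smooth_cubic_rat_with_nine_lines :
    ∃ f : MvPolynomial (Fin 4) ℚ, IsSmoothCubic ℚ f ∧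
      {W : Submodule ℚ (Fin 4 → ℚ) | IsLineOn f W}.Finite ∧
      {W : Submodule ℚ (Fin 4 → ℚ) | IsLineOn f W}.ncard = 9 := by
  refine exists_smooth_cubic_of_allLinesLift 2 [(1, 1, 2, 2), (-1, 1, 1, 2), (-1, 0, 2, 3), (1, 0,
    3, 3), (1, 0, 0, 3)] [(![1, 0, 0, 0], ![0, 1, 0, 0]), (![1, 0, 0, 0], ![0, 1, 1, 0]), (![1, 0,
    0, -1], ![0, 1, 0, 0]), (![1, 0, 0, -1], ![0, 1, 1, 1]), (![1, 0, 0, 0], ![0, 0, 1, 0]), (![1,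
    0, 0, -1], ![0, 0, 1, 1]), (![0, 1, 0, 0], ![0, 0, 0, 1]), (![0, 1, 1, 0], ![0, 0, 0, 1]),
    (![0, 0, 1, 0], ![0, 0, 0, 1])] ?_ (by decide +kernel) (by decide +kernel) (by decide +kernel)
    (by decide +kernel)
  intro a b c d h
  have h0 := h 0
  have h1 := h 1
  have h2 := h 2
  have h3 := h 3
  simp [trilinear, Pi.single_apply, -mul_eq_zero] at h0 h1 h2 h3
  obtain rfl : c = 0 := by
    refine pow_eq_zero_iff (n := 5) (by decide) |>.1 ?_
    linear_combination (8 / 23 * a * c * d + 36 / 23 * b * c ^ 2 - 16 / 69 * a * c ^ 2) * h0 + (c ^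
      3 - 2 / 3 * b * c ^ 2 - 12 / 23 * b * c * d + 12 / 23 * b * d ^ 2 + 36 / 23 * a * c * d) * h1
      + (4 / 3 * c ^ 3 - 24 / 23 * c * d ^ 2 + 24 / 23 * c ^ 2 * d) * h2 + (-16 / 23 * c * d ^ 2 +
      32 / 69 * c ^ 2 * d) * h3
  obtain rfl : a = 0 := by
    refine pow_eq_zero_iff (n := 3) (by decide) |>.1 ?_
    linear_combination -4 / 3 * a * h0 + (2 / 3 * d + a) * h3
  obtain rfl : b = 0 := by
    refine pow_eq_zero_iff (n := 2) (by decide) |>.1 ?_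
    linear_combination -h2
  obtain rfl : d = 0 := by
    refine pow_eq_zero_iff (n := 2) (by decide) |>.1 ?_
    linear_combination h0
  exact ⟨rfl, rfl, rfl, rfl⟩

theorem exists_smooth_cubic_rat_with_fifteen_lines :
    ∃ f : MvPolynomial (Fin 4) ℚ, IsSmoothCubic ℚ f ∧
      {W : Submodule ℚ (Fin 4 → ℚ) | IsLineOn f W}.Finite ∧
      {W : Submodule ℚ (Fin 4 → ℚ) | IsLineOn f W}.ncard = 15 := by
  refine exists_smooth_cubic_of_allLinesLift 2 [(1, 0, 0, 1), (1, 0, 1, 1), (1, 2, 2, 3), (1, 2, 3,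
    3)] [(![1, 0, 0, -1], ![0, 1, -1, 0]), (![1, 0, 0, 1], ![0, 1, -1, 1]), (![1, 0, -1, 0], ![0,
    1, 0, -1]), (![1, 0, 1, 0], ![0, 1, 1, -1]), (![1, 0, -1, 1], ![0, 1, 0, 1]), (![1, 0, 1, -1],
    ![0, 1, 1, 0]), (![1, 0, 0, 0], ![0, 0, 1, 0]), (![1, 0, 0, 0], ![0, 0, 1, -1]), (![1, -1, 0,
    0], ![0, 0, 1, 0]), (![1, -1, 0, 0], ![0, 0, 1, -1]), (![1, 0, 0, 0], ![0, 0, 0, 1]), (![1, -1,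
    0, 0], ![0, 0, 0, 1]), (![0, 1, 0, 0], ![0, 0, 1, 0]), (![0, 1, 0, 0], ![0, 0, 1, -1]), (![0,
    1, 0, 0], ![0, 0, 0, 1])] ?_ (by decide +kernel) (by decide +kernel) (by decide +kernel)
    (by decide +kernel)
  intro a b c d h
  have h0 := h 0
  have h1 := h 1
  have h2 := h 2
  have h3 := h 3
  simp [trilinear, Pi.single_apply, -mul_eq_zero] at h0 h1 h2 h3
  obtain rfl : a = 0 := by
    refine pow_eq_zero_iff (n := 3) (by decide) |>.1 ?_
    linear_combination -4 / 3 * a * h0 + (2 / 3 * b + a) * h1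
  obtain rfl : b = 0 := by
    refine pow_eq_zero_iff (n := 2) (by decide) |>.1 ?_
    linear_combination h0
  obtain rfl : c = 0 := by
    refine pow_eq_zero_iff (n := 3) (by decide) |>.1 ?_
    linear_combination -4 / 3 * c * h2 + (2 / 3 * d + c) * h3
  obtain rfl : d = 0 := by
    refine pow_eq_zero_iff (n := 2) (by decide) |>.1 ?_
    linear_combination h2
  exact ⟨rfl, rfl, rfl, rfl⟩

theorem exists_smooth_cubic_rat_with_twentySeven_lines :
    ∃ f : MvPolynomial (Fin 4) ℚ, IsSmoothCubic ℚ f ∧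
      {W : Submodule ℚ (Fin 4 → ℚ) | IsLineOn f W}.Finite ∧
      {W : Submodule ℚ (Fin 4 → ℚ) | IsLineOn f W}.ncard = 27 := by
  have : Fact (Nat.Prime 7) := ⟨by norm_num⟩
  refine exists_smooth_cubic_of_allLinesLift 7 [(-3, 0, 0, 3), (1, 0, 1, 2), (2, 1, 1, 2), (5, 0,
    2, 3), (-3, 0, 3, 3), (-3, 1, 2, 2), (1, 1, 2, 3)] [(![1, 0, 0, 0], ![0, 1, 0, 0]), (![1, 0, 0,
    -1], ![0, 1, 0, 0]), (![1, 0, 0, -1], ![0, 2, 3, 5]), (![1, 0, 1, 0], ![0, 1, 0, 1]), (![1, 0,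
    1, 0], ![0, 1, 1, 1]), (![3, 0, 3, 2], ![0, 3, 0, -2]), (![1, 0, 3, 0], ![0, 1, 0, 2]), (![3,
    0, 2, 0], ![0, 3, 4, 6]), (![1, 0, 3, 4], ![0, 1, 0, -1]), (![2, 0, 1, 0], ![0, 2, 0, -1]),
    (![6, 0, 3, -1], ![0, 3, 0, 2]), (![1, 0, -3, -6], ![0, 1, 2, 4]), (![3, 0, 1, 0], ![0, 3, 2,
    0]), (![2, 0, 3, 3], ![0, 1, 1, 1]), (![1, 0, -1, 0], ![0, 2, 1, -1]), (![4, 0, 3, 1], ![0, 4,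
    3, 1]), (![1, 0, 0, 0], ![0, 0, 1, 0]), (![1, 0, 0, -1], ![0, 0, 3, 5]), (![1, 1, 0, 0], ![0,
    0, 1, 1]), (![1, 1, 0, -1], ![0, 0, 1, 1]), (![2, 1, 0, 0], ![0, 0, 3, 1]), (![2, 1, 0, -2],
    ![0, 0, 2, 3]), (![1, -2, 0, 0], ![0, 0, 1, 2]), (![1, -2, 0, -1], ![0, 0, 1, -1]), (![0, 1, 0,
    -2], ![0, 0, 1, 3]), (![0, 1, 0, 0], ![0, 0, 0, 1]), (![0, 0, 1, 0], ![0, 0, 0, 1])] ?_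
    (by decide +kernel) (by decide +kernel) (by decide +kernel) (by decide +kernel)
  intro a b c d h
  have h0 := h 0
  have h1 := h 1
  have h2 := h 2
  have h3 := h 3
  simp [trilinear, Pi.single_apply, -mul_eq_zero] at h0 h1 h2 h3
  obtain rfl : d = 0 := by
    refine pow_eq_zero_iff (n := 5) (by decide) |>.1 ?_
    linear_combination (-1 / 3 * d ^ 3 - 711107 / 366120 * c * d ^ 2 + 253457 / 122040 * c ^ 2 * d
      + 163391 / 50850 * a ^ 3 + 2 / 3 * a * d ^ 2 + 174691 / 25425 * a ^ 2 * d - 18319 / 3051 * a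
      * c ^ 2 - 73276 / 8475 * b * c ^ 2 - 2618221 / 457650 * b * c * d + 6449687 / 366120 * a * c
      * d - 238147 / 45765 * a ^ 2 * c + 2626357 / 228825 * a * b * c) * h0 + (-507707 / 122040 * d
      ^ 3 - 13879 / 76275 * a ^ 2 * b + 567889 / 45765 * a * b * c - 517931 / 76275 * a * b ^ 2 +
      11861653 / 1830600 * b * c * d + 534 / 2825 * b * d ^ 2 + 253457 / 73224 * c * d ^ 2 - 543556
      / 76275 * a * b * d - 91595 / 9153 * a * c * d) * h1 + (-92483 / 30510 * a ^ 2 * c + 1656293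
      / 152550 * a * c * d - 256762 / 25425 * c ^ 2 * d - 1068 / 2825 * c * d ^ 2 + 1035862 / 76275
      * a * b * c) * h2 + (-208591 / 50850 * a * d ^ 2 + 73276 / 8475 * b * c ^ 2 - 163391 / 25425
      * a ^ 2 * d - 49621 / 6780 * c * d ^ 2) * h3
  obtain rfl : a = 0 := by
    refine pow_eq_zero_iff (n := 3) (by decide) |>.1 ?_
    linear_combination (5 / 4 * c + 26 / 3 * a) * h0 + -25 / 12 * a * h1 + (-5 / 4 * c - 1 / 3 * a)
      * h3
  obtain rfl : b = 0 := by
    refine pow_eq_zero_iff (n := 2) (by decide) |>.1 ?_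
    linear_combination 3 * h0 + 1 / 2 * h2
  obtain rfl : c = 0 := by
    refine pow_eq_zero_iff (n := 2) (by decide) |>.1 ?_
    linear_combination -1 / 3 * h1
  exact ⟨rfl, rfl, rfl, rfl⟩

/-- each count in {0,1,2,3,5,7,9,15,27} is realized by a smooth cubic
surface over ℚ. -/
theorem exists_smooth_cubic_rat_with_line_count :
    ∀ n ∈ ({0, 1, 2, 3, 5, 7, 9, 15, 27} : Set ℕ),
      ∃ f : MvPolynomial (Fin 4) ℚ, IsSmoothCubic ℚ f ∧
        {W : Submodule ℚ (Fin 4 → ℚ) | IsLineOn f W}.Finite ∧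
        {W : Submodule ℚ (Fin 4 → ℚ) | IsLineOn f W}.ncard = n := by
  intro n hn
  rcases hn with rfl | rfl | rfl | rfl | rfl | rfl | rfl | rfl | rfl
  · exact exists_smooth_cubic_rat_with_no_line
  · exact exists_smooth_cubic_rat_with_one_line
  · exact exists_smooth_cubic_rat_with_two_lines
  · exact exists_smooth_cubic_rat_with_three_lines
  · exact exists_smooth_cubic_rat_with_five_lines
  · exact exists_smooth_cubic_rat_with_seven_lines
  · exact exists_smooth_cubic_rat_with_nine_lines
  · exact exists_smooth_cubic_rat_with_fifteen_lines
  · exact exists_smooth_cubic_rat_with_twentySeven_lines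
end
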